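/- arXiv:1705.01199 — 3 statements merged into one kernel-verified Lean document; each statement's English description precedes it below -/
import Mathlib

section
/- A multigraph G is 4-edge-connected if and only if, for any vertex r of G, the graph G can be constructed as follows: begin with the graph G^0 consisting of r and one other vertex of G joined by four parallel edges, and then repeatedly perform Mader operations to obtain G. -/
set_option autoImplicit false

/-- A multigraph: a type of vertices, a type of edges, and a map assigning to each
edge its unordered pair of endpoints (a loop has endpoints `s(v, v)`). -/
structure MG : Type 1 where
  V : Type
  E : Type
  ends : E → Sym2 V

namespace MG

variable (G : MG)

/-- The set of vertices covered by a set `F` of edges. -/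
def vertsOf (F : Set G.E) : Set G.V := {v | ∃ e ∈ F, v ∈ G.ends e}

/-- The degree of a vertex `v` with respect to a set `F` of edges;
a loop contributes two to the degree. -/
noncomputable def deg (F : Set G.E) (v : G.V) : ℕ :=
  {e ∈ F | v ∈ G.ends e}.ncard + {e ∈ F | G.ends e = s(v, v)}.ncard

/-- `G` has no isolated vertices. -/
def NoIsolated : Prop := ∀ v : G.V, ∃ e : G.E, v ∈ G.ends e

/-- `IsLink vs es`: the edge list `es` successively links the consecutive
vertices of the vertex list `vs`. -/
def IsLink : List G.V → List G.E → Prop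
  | [_], [] => True
  | a :: b :: vs, e :: es => G.ends e = s(a, b) ∧ IsLink (b :: vs) es
  | _, _ => False

/-- `vs, es` form a (simple) path: distinct vertices, distinct edges, consecutive linking. -/
def IsPath (vs : List G.V) (es : List G.E) : Prop :=
  vs.Nodup ∧ es.Nodup ∧ G.IsLink vs es

/-- `v :: vs, es` form a (simple) cycle through the basepoint `v`:
the distinct vertices `v :: vs` are linked cyclically by the distinct edges `es`.
A loop gives a cycle of length one and two parallel edges give a cycle of length two. -/
def IsCycle (v : G.V) (vs : List G.V) (es : List G.E) : Prop :=
  (v :: vs).Nodup ∧ es.Nodup ∧ es ≠ [] ∧ G.IsLink (v :: (vs ++ [v])) es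

/-- Reachability using only edges from `F`. -/
def Reach (F : Set G.E) : G.V → G.V → Prop :=
  Relation.ReflTransGen (fun a b => ∃ e ∈ F, G.ends e = s(a, b))

/-- `G` with edge set restricted to `F` is connected as a graph on all of `G.V`. -/
def ConnectedOn (F : Set G.E) : Prop := ∀ a b : G.V, G.Reach F a b

/-- The subgraph formed by the edge set `F` together with the vertices it covers
is connected. -/
def ConnectedWithin (F : Set G.E) : Prop :=
  ∀ a ∈ G.vertsOf F, ∀ b ∈ G.vertsOf F, G.Reach F a b

/-- `G` is 4-edge-connected: at least two vertices, and deleting any set of fewer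
than four edges leaves the graph connected. -/
def FourEdgeConnected : Prop :=
  2 ≤ Nat.card G.V ∧ ∀ S : Set G.E, S.Finite → S.ncard < 4 → G.ConnectedOn Sᶜ

/-- `e` is a cut edge of the subgraph formed by the edge set `F`: removing `e`
disconnects two vertices of that subgraph. -/
def IsCutEdge (F : Set G.E) (e : G.E) : Prop :=
  e ∈ F ∧ ∃ a ∈ G.vertsOf F, ∃ b ∈ G.vertsOf F, ¬ G.Reach (F \ {e}) a b

/-! ### Chains -/

/-- An open up chain with respect to `(H, Hb)`, rooted at `r`: a path with at least
one edge, edge-disjoint from `H` and `Hb`, in which every vertex is `r` or has degree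
at least two in `Hb`, and whose ends are `r` or lie in `H`. -/
def IsOpenUpChain (r : G.V) (H Hb C : Set G.E) : Prop :=
  Disjoint C H ∧ Disjoint C Hb ∧
  ∃ vs es, G.IsPath vs es ∧ es ≠ [] ∧ C = {e | e ∈ es} ∧
    (∀ v ∈ vs, v = r ∨ 2 ≤ G.deg Hb v) ∧
    (∀ v, vs.head? = some v → v = r ∨ v ∈ G.vertsOf H) ∧
    (∀ v, vs.getLast? = some v → v = r ∨ v ∈ G.vertsOf H)

/-- A closed up chain with respect to `(H, Hb)`, rooted at `r`, with common end `v`: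
a cycle through `v`, edge-disjoint from `H` and `Hb`, in which every vertex is `r` or
has degree at least two in `Hb`, and the end `v` is `r` or has degree at least two in `H`. -/
def IsClosedUpChain (r : G.V) (H Hb C : Set G.E) (v : G.V) : Prop :=
  Disjoint C H ∧ Disjoint C Hb ∧
  ∃ vs es, G.IsCycle v vs es ∧ C = {e | e ∈ es} ∧
    (∀ u ∈ v :: vs, u = r ∨ 2 ≤ G.deg Hb u) ∧
    (v = r ∨ 2 ≤ G.deg H v)

/-- An up chain with respect to `(H, Hb)`. -/
def IsUpChain (r : G.V) (H Hb C : Set G.E) : Prop :=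
  G.IsOpenUpChain r H Hb C ∨ ∃ v, G.IsClosedUpChain r H Hb C v

/-- A down chain with respect to `(H, Hb)` is an up chain with respect to `(Hb, H)`. -/
def IsDownChain (r : G.V) (H Hb C : Set G.E) : Prop := G.IsUpChain r Hb H C

/-- A closed down chain with respect to `(H, Hb)` with common end `v`. -/
def IsClosedDownChain (r : G.V) (H Hb C : Set G.E) (v : G.V) : Prop :=
  G.IsClosedUpChain r Hb H C v

/-- A one-way chain with respect to `(H, Hb)`, with tail `u` and head `v`:
a single edge `e ∉ H ∪ Hb` with ends `u` and `v`, where the tail `u` is `r` or has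
degree at least two in `H`, and the head `v` is `r` or has degree at least two in `Hb`. -/
def IsOneWayChainAt (r : G.V) (H Hb C : Set G.E) (u v : G.V) : Prop :=
  ∃ e, e ∉ H ∧ e ∉ Hb ∧ C = {e} ∧ G.ends e = s(u, v) ∧
    (u = r ∨ 2 ≤ G.deg H u) ∧ (v = r ∨ 2 ≤ G.deg Hb v)

/-- A one-way chain with respect to `(H, Hb)`. -/
def IsOneWayChain (r : G.V) (H Hb C : Set G.E) : Prop :=
  ∃ u v, G.IsOneWayChainAt r H Hb C u v

/-- A chain with respect to `(H, Hb)`: an up chain, a down chain, or a one-way chain. -/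
def IsChain (r : G.V) (H Hb C : Set G.E) : Prop :=
  G.IsUpChain r H Hb C ∨ G.IsDownChain r H Hb C ∨ G.IsOneWayChain r H Hb C

/-- `H_i`: the union of the chains with index `< i`. -/
def before {n : ℕ} (Gs : Fin n → Set G.E) (i : Fin n) : Set G.E :=
  {e | ∃ j, j < i ∧ e ∈ Gs j}

/-- `Hbar_i`: the union of the chains with index `> i`. -/
def after {n : ℕ} (Gs : Fin n → Set G.E) (i : Fin n) : Set G.E :=
  {e | ∃ j, i < j ∧ e ∈ Gs j}

/-- `Gs` is a chain decomposition, rooted at `r`, of the part of `G` with edge set `F`: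
the `Gs i` partition `F`, and each `Gs i` is an up chain, a down chain or a one-way
chain with respect to `(H_i, Hbar_i)`. -/
def IsChainDecompOn (F : Set G.E) (r : G.V) {n : ℕ} (Gs : Fin n → Set G.E) : Prop :=
  (∀ i j, i ≠ j → Disjoint (Gs i) (Gs j)) ∧ (⋃ i, Gs i) = F ∧
  ∀ i, G.IsChain r (G.before Gs i) (G.after Gs i) (Gs i)

/-- `Gs` is a chain decomposition of `G` rooted at `r`. -/
def IsChainDecomp (r : G.V) {n : ℕ} (Gs : Fin n → Set G.E) : Prop :=
  G.IsChainDecompOn Set.univ r Gs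

/-- `G` has a chain decomposition rooted at `r`. -/
def HasChainDecomp (r : G.V) : Prop :=
  ∃ (m : ℕ) (Gs : Fin (m + 1) → Set G.E), G.IsChainDecomp r Gs

/-- A minimal open up chain: an open up chain none of whose internal vertices
lies in `{r} ∪ V(H)`. -/
def IsMinimalOpenUpChain (r : G.V) (H Hb C : Set G.E) : Prop :=
  Disjoint C H ∧ Disjoint C Hb ∧
  ∃ vs es, G.IsPath vs es ∧ es ≠ [] ∧ C = {e | e ∈ es} ∧
    (∀ v ∈ vs, v = r ∨ 2 ≤ G.deg Hb v) ∧
    (∀ v, vs.head? = some v → v = r ∨ v ∈ G.vertsOf H) ∧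
    (∀ v, vs.getLast? = some v → v = r ∨ v ∈ G.vertsOf H) ∧
    (∀ v ∈ vs, vs.head? ≠ some v → vs.getLast? ≠ some v → v ≠ r ∧ v ∉ G.vertsOf H)

/-- A minimal up chain: an up chain none of whose internal vertices lies in
`{r} ∪ V(H)`. -/
def IsMinimalUpChain (r : G.V) (H Hb C : Set G.E) : Prop :=
  G.IsMinimalOpenUpChain r H Hb C ∨
  ∃ v, G.IsClosedUpChain r H Hb C v ∧
    ∀ u ∈ G.vertsOf C, u ≠ v → u ≠ r ∧ u ∉ G.vertsOf H

/-- A minimal down chain: a down chain none of whose internal vertices lies in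
`{r} ∪ V(Hb)`. -/
def IsMinimalDownChain (r : G.V) (H Hb C : Set G.E) : Prop :=
  G.IsMinimalUpChain r Hb H C

/-- A minimal chain decomposition (of the part of `G` with edge set `F`):
a chain decomposition all of whose up chains and down chains are minimal. -/
def IsMinimalChainDecompOn (F : Set G.E) (r : G.V) {n : ℕ} (Gs : Fin n → Set G.E) : Prop :=
  G.IsChainDecompOn F r Gs ∧
  ∀ i, G.IsMinimalUpChain r (G.before Gs i) (G.after Gs i) (Gs i) ∨
       G.IsMinimalDownChain r (G.before Gs i) (G.after Gs i) (Gs i) ∨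
       G.IsOneWayChain r (G.before Gs i) (G.after Gs i) (Gs i)

/-- A minimal chain decomposition of `G` rooted at `r`. -/
def IsMinimalChainDecomp (r : G.V) {n : ℕ} (Gs : Fin n → Set G.E) : Prop :=
  G.IsMinimalChainDecompOn Set.univ r Gs

/-! ### Subgraphs, trees and edge-independence -/

/-- A subgraph of `G`: a set of vertices together with a set of edges all of whose
endpoints lie in the vertex set. -/
structure Sub (G : MG) where
  verts : Set G.V
  edges : Set G.E
  valid : ∀ e ∈ edges, ∀ v ∈ G.ends e, v ∈ verts

/-- A subgraph is connected. -/
def Sub.Connected {G : MG} (T : Sub G) : Prop :=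
  T.verts.Nonempty ∧ ∀ a ∈ T.verts, ∀ b ∈ T.verts,
    Relation.ReflTransGen (fun x y => ∃ e ∈ T.edges, G.ends e = s(x, y)) a b

/-- A subgraph is a tree: connected and containing no cycle. -/
def Sub.IsTree {G : MG} (T : Sub G) : Prop :=
  T.Connected ∧ ¬ ∃ v vs es, G.IsCycle v vs es ∧ ∀ e ∈ es, e ∈ T.edges

/-- A subgraph is spanning. -/
def Sub.Spanning {G : MG} (T : Sub G) : Prop := T.verts = Set.univ

/-- `vs, es` is a path from `a` to `b` all of whose edges lie in the subgraph `T`. -/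
def Sub.PathIn {G : MG} (T : Sub G) (a b : G.V) (vs : List G.V) (es : List G.E) : Prop :=
  G.IsPath vs es ∧ vs.head? = some a ∧ vs.getLast? = some b ∧ ∀ e ∈ es, e ∈ T.edges

/-- Two subtrees of `G` are edge-independent with root `r`: each contains `r`, and for
every common vertex `v`, the path between `r` and `v` in one tree is edge-disjoint from
the path between `r` and `v` in the other. -/
def EdgeIndependent (r : G.V) (T₁ T₂ : Sub G) : Prop :=
  r ∈ T₁.verts ∧ r ∈ T₂.verts ∧
  ∀ v ∈ T₁.verts ∩ T₂.verts, ∀ vs₁ es₁ vs₂ es₂,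
    T₁.PathIn r v vs₁ es₁ → T₂.PathIn r v vs₂ es₂ → ∀ e ∈ es₁, e ∉ es₂

/-- `G` has a set of four edge-independent spanning trees rooted at `r`. -/
def HasFourEIST (r : G.V) : Prop :=
  ∃ T : Fin 4 → Sub G, (∀ i, (T i).IsTree ∧ (T i).Spanning) ∧
    ∀ i j, i ≠ j → G.EdgeIndependent r (T i) (T j)

/-! ### Mader operations -/

/-- Add to `G` a new edge with the (not necessarily distinct) endpoints `p`. -/
def addEdge (p : Sym2 G.V) : MG :=
  ⟨G.V, Option G.E, fun e => e.elim p G.ends⟩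

/-- Pinch the two distinct edges `e₁` (with ends `x`, `y`) and `e₂` (with ends `z`, `w`):
delete `e₁` and `e₂`, add a new vertex (`none`), and add four new edges joining the new
vertex to `x`, `y`, `z`, `w` respectively. -/
def pinch (e₁ e₂ : G.E) (x y z w : G.V) : MG where
  V := Option G.V
  E := {e : G.E // e ≠ e₁ ∧ e ≠ e₂} ⊕ Fin 4
  ends := fun e =>
    Sum.elim (fun e' => (G.ends e'.1).map some)
      (fun i =>
        if i = 0 then s((none : Option G.V), some x)
        else if i = 1 then s((none : Option G.V), some y)
        else if i = 2 then s((none : Option G.V), some z)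
        else s((none : Option G.V), some w)) e

end MG

/-- A multigraph with a distinguished root vertex. -/
structure PMG : Type 1 where
  G : MG
  r : G.V

/-- A single Mader operation on a rooted multigraph: either add an edge, or pinch two
distinct edges. -/
inductive MaderStep : PMG → PMG → Prop
  | addEdge (P : PMG) (p : Sym2 P.G.V) : MaderStep P ⟨P.G.addEdge p, P.r⟩
  | pinch (P : PMG) (e₁ e₂ : P.G.E) (x y z w : P.G.V) (hne : e₁ ≠ e₂)
      (h₁ : P.G.ends e₁ = s(x, y)) (h₂ : P.G.ends e₂ = s(z, w)) :
      MaderStep P ⟨P.G.pinch e₁ e₂ x y z w, some P.r⟩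

/-- The starting graph `G⁰` of the Mader construction: two vertices joined by four
parallel edges, rooted at one of them. -/
def basePMG : PMG :=
  ⟨⟨Bool, Fin 4, fun _ => s(false, true)⟩, false⟩

/-- An isomorphism of rooted multigraphs: bijections on vertices and edges commuting
with the endpoint maps and sending root to root. -/
def PIso (P Q : PMG) : Prop :=
  ∃ (fV : P.G.V ≃ Q.G.V) (fE : P.G.E ≃ Q.G.E),
    (∀ e, Q.G.ends (fE e) = (P.G.ends e).map fV) ∧ fV P.r = Q.r

/-- `G`, rooted at `r`, can be built from `basePMG` by repeatedly performing
Mader operations. -/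
def MaderConstructible (G : MG) (r : G.V) : Prop :=
  ∃ Q : PMG, Relation.ReflTransGen MaderStep basePMG Q ∧ PIso Q ⟨G, r⟩

namespace MG

/-! ### Edge cuts -/

/-- The pair `p` has an element in `X` and an element outside `X`. -/
def Crosses {α : Type} (X : Set α) (p : Sym2 α) : Prop :=
  (∃ a ∈ p, a ∈ X) ∧ ∃ a ∈ p, a ∉ X

theorem crosses_mk {α : Type} (X : Set α) (a b : α) :
    Crosses X s(a, b) ↔ (a ∈ X ∧ b ∉ X) ∨ (a ∉ X ∧ b ∈ X) := by
  simp only [Crosses, Sym2.mem_iff, exists_eq_or_imp, exists_eq_left]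
  tauto

theorem crosses_map {α β : Type} (f : α → β) (X : Set β) (p : Sym2 α) :
    Crosses X (p.map f) ↔ Crosses (f ⁻¹' X) p := by
  induction p with
  | _ a b => simp [crosses_mk]

open Classical in
/-- The indicator of `Crosses X p`. -/
noncomputable def cross {α : Type} (X : Set α) (p : Sym2 α) : ℕ :=
  if Crosses X p then 1 else 0

theorem cross_map {α β : Type} (f : α → β) (X : Set β) (p : Sym2 α) :
    cross X (p.map f) = cross (f ⁻¹' X) p := by
  classical exact if_congr (crosses_map f X p) rfl rfl

theorem cross_compl {α : Type} (X : Set α) (p : Sym2 α) : cross Xᶜ p = cross X p := by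
  induction p with
  | _ a b =>
    by_cases a ∈ X <;> by_cases b ∈ X <;> simp [cross, crosses_mk, *]

/-- The number of edges of `G` with exactly one end in `X`. -/
noncomputable def cutSize (G : MG) (X : Set G.V) : ℕ :=
  {e | Crosses X (G.ends e)}.ncard

theorem cutSize_eq_sum (G : MG) [Fintype G.E] (X : Set G.V) :
    G.cutSize X = ∑ e, cross X (G.ends e) := by
  classical
  simp only [cutSize, cross, Set.ncard_eq_toFinset_card', Finset.sum_boole, Nat.cast_id]
  congr 1
  ext e
  simp

theorem cutSize_compl (G : MG) [Finite G.E] (X : Set G.V) : G.cutSize Xᶜ = G.cutSize X := by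
  cases nonempty_fintype G.E
  simp [cutSize_eq_sum, cross_compl]

theorem cutSize_inter_add_cutSize_union_le (G : MG) [Finite G.E] (X Y : Set G.V) :
    G.cutSize (X ∩ Y) + G.cutSize (X ∪ Y) ≤ G.cutSize X + G.cutSize Y := by
  cases nonempty_fintype G.E
  simp only [cutSize_eq_sum, ← Finset.sum_add_distrib]
  refine Finset.sum_le_sum fun e _ => ?_
  induction G.ends e with
  | _ a b =>
    by_cases a ∈ X <;> by_cases b ∈ X <;> by_cases a ∈ Y <;> by_cases b ∈ Y <;>
      simp [cross, crosses_mk, *]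

theorem cutSize_inter_add_cutSize_compl_inter_compl_le (G : MG) [Finite G.E] (X Y : Set G.V) :
    G.cutSize (X ∩ Y) + G.cutSize (Xᶜ ∩ Yᶜ) ≤ G.cutSize X + G.cutSize Y := by
  rw [← Set.compl_union, cutSize_compl]
  exact G.cutSize_inter_add_cutSize_union_le X Y

theorem even_cutSize_inter_add_cutSize_inter_compl_add (G : MG) [Finite G.E] (X Y : Set G.V) :
    Even (G.cutSize (X ∩ Y) + G.cutSize (X ∩ Yᶜ) + G.cutSize X) := by
  cases nonempty_fintype G.E
  simp only [cutSize_eq_sum, ← Finset.sum_add_distrib]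
  refine Finset.even_sum _ fun e _ => ?_
  induction G.ends e with
  | _ a b =>
    by_cases a ∈ X <;> by_cases b ∈ X <;> by_cases a ∈ Y <;> by_cases b ∈ Y <;>
      simp [cross, crosses_mk, *]

theorem fourEdgeConnected_iff_cutSize (G : MG) [Finite G.E] :
    G.FourEdgeConnected ↔
      2 ≤ Nat.card G.V ∧ ∀ X : Set G.V, X.Nonempty → X ≠ Set.univ → 4 ≤ G.cutSize X := by
  refine and_congr_right fun _ => ⟨fun h X hX hX' => ?_, fun h S _ hS a b => ?_⟩
  · by_contra! hlt
    obtain ⟨a, ha⟩ := hX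
    obtain ⟨b, hb⟩ := (Set.ne_univ_iff_exists_notMem X).1 hX'
    have stay : ∀ c, G.Reach {e | Crosses X (G.ends e)}ᶜ a c → c ∈ X := by
      intro c hc
      induction hc with
      | refl => exact ha
      | tail _ hstep ih =>
        obtain ⟨e, he, hends⟩ := hstep
        by_contra hcon
        exact he (by simp [hends, crosses_mk, ih, hcon])
    exact hb (stay b (h _ (Set.toFinite _) hlt a b))
  · by_contra hb
    have h4 := h {c | G.Reach Sᶜ a c} ⟨a, Relation.ReflTransGen.refl⟩
      fun hu => hb (Set.eq_univ_iff_forall.1 hu b)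
    have hsub : {e | Crosses {c | G.Reach Sᶜ a c} (G.ends e)} ⊆ S := by
      intro e he
      by_contra heS
      revert he
      simp only [Set.mem_ofPred_eq]
      generalize hp : G.ends e = p
      induction p with
      | _ u v =>
        rw [crosses_mk]
        rintro (⟨hu, hv⟩ | ⟨hu, hv⟩)
        · exact hv (hu.tail ⟨e, heS, hp⟩)
        · exact hu (hv.tail ⟨e, heS, hp.trans Sym2.eq_swap⟩)
    have := Set.ncard_le_ncard hsub (Set.toFinite S)
    unfold cutSize at h4
    omega

theorem FourEdgeConnected.four_le_cutSize {G : MG} [Finite G.E] (h : G.FourEdgeConnected)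
    {X : Set G.V} (hX : X.Nonempty) (hX' : X ≠ Set.univ) : 4 ≤ G.cutSize X :=
  (G.fourEdgeConnected_iff_cutSize.1 h).2 X hX hX'

/-! ### Adding and deleting edges, attaching a vertex of degree four -/

/-- A reducible version of `addEdge`. -/
abbrev insertEdge (G : MG) (p : Sym2 G.V) : MG :=
  ⟨G.V, Option G.E, fun e => e.elim p G.ends⟩

/-- Delete the edge `e`. -/
abbrev deleteEdge (G : MG) (e : G.E) : MG :=
  ⟨G.V, {f : G.E // f ≠ e}, fun f => G.ends f⟩

/-- Add a new vertex joined by four edges to `t 0`, `t 1`, `t 2`, `t 3`. -/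
abbrev addVertex (G : MG) (t : Fin 4 → G.V) : MG :=
  ⟨Option G.V, G.E ⊕ Fin 4,
    Sum.elim (fun e => (G.ends e).map some) (fun i => s(none, some (t i)))⟩

theorem cutSize_insertEdge (G : MG) [Finite G.E] (p : Sym2 G.V) (X : Set G.V) :
    (G.insertEdge p).cutSize X = G.cutSize X + cross X p := by
  cases nonempty_fintype G.E
  let : Fintype (G.insertEdge p).E := inferInstanceAs (Fintype (Option G.E))
  rw [cutSize_eq_sum, cutSize_eq_sum, add_comm]
  exact Fintype.sum_option _

theorem cutSize_addVertex (G : MG) [Finite G.E] (t : Fin 4 → G.V) (X : Set (Option G.V)) :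
    (G.addVertex t).cutSize X =
      G.cutSize (some ⁻¹' X) + ∑ i, cross X s(none, some (t i)) := by
  cases nonempty_fintype G.E
  let : Fintype (G.addVertex t).E := inferInstanceAs (Fintype (G.E ⊕ Fin 4))
  rw [cutSize_eq_sum, cutSize_eq_sum]
  refine (Fintype.sum_sum_type _).trans ?_
  congr 1
  exact Finset.sum_congr rfl fun e _ => cross_map _ _ _

end MG

open MG

/-! ### Isomorphisms of rooted multigraphs -/

theorem PIso.symm {P Q : PMG} (h : PIso P Q) : PIso Q P := by
  obtain ⟨fV, fE, hends, hr⟩ := h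
  refine ⟨fV.symm, fE.symm, fun e => ?_, by simp [← hr]⟩
  have := hends (fE.symm e)
  rw [Equiv.apply_symm_apply] at this
  rw [this, Sym2.map_map]
  simp

theorem PIso.trans {P Q R : PMG} (h : PIso P Q) (h' : PIso Q R) : PIso P R := by
  obtain ⟨fV, fE, hends, hr⟩ := h
  obtain ⟨gV, gE, hends', hr'⟩ := h'
  refine ⟨fV.trans gV, fE.trans gE, fun e => ?_, by simp [hr, hr']⟩
  simp [hends, hends', Sym2.map_map]

theorem PIso.fourEdgeConnected {P Q : PMG} [Finite P.G.E] [Finite Q.G.E] (h : PIso P Q)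
    (hP : P.G.FourEdgeConnected) : Q.G.FourEdgeConnected := by
  obtain ⟨fV, fE, hends, -⟩ := h
  rw [fourEdgeConnected_iff_cutSize] at hP ⊢
  refine ⟨Nat.card_congr fV ▸ hP.1, fun X hX hX' => ?_⟩
  have hcut : Q.G.cutSize X = P.G.cutSize (fV ⁻¹' X) := by
    cases nonempty_fintype P.G.E
    cases nonempty_fintype Q.G.E
    rw [cutSize_eq_sum, cutSize_eq_sum]
    refine (Fintype.sum_equiv fE _ _ fun e => ?_).symm
    rw [hends, cross_map]
  rw [hcut]
  refine hP.2 _ (hX.preimage fV.surjective) fun hu => hX' ?_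
  rw [Set.eq_univ_iff_forall] at hu ⊢
  intro v
  simpa using hu (fV.symm v)

theorem pIso_insertEdge_deleteEdge (G : MG) (e : G.E) (r : G.V) :
    PIso ⟨(G.deleteEdge e).insertEdge (G.ends e), r⟩ ⟨G, r⟩ := by
  classical
  refine ⟨Equiv.refl _, Equiv.optionSubtypeNe e, fun f => ?_, rfl⟩
  cases f <;> exact (congrFun Sym2.map_id _).symm

theorem MG.cutSize_deleteEdge_add (G : MG) [Finite G.E] (e : G.E) (X : Set G.V) :
    (G.deleteEdge e).cutSize X + cross X (G.ends e) = G.cutSize X := by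
  classical
  cases nonempty_fintype G.E
  let : Fintype (G.deleteEdge e).E := inferInstanceAs (Fintype {f : G.E // f ≠ e})
  rw [cutSize_eq_sum, cutSize_eq_sum, add_comm]
  let g : Option {f : G.E // f ≠ e} → ℕ :=
    fun f => f.elim (cross X (G.ends e)) fun f => cross X (G.ends f)
  exact (Fintype.sum_option g).symm.trans <|
    Fintype.sum_equiv (Equiv.optionSubtypeNe e) g _ fun f => by cases f <;> rfl

theorem pIso_addVertex_comp_perm (K : MG) (t : Fin 4 → K.V) (σ : Equiv.Perm (Fin 4))
    (r : Option K.V) : PIso ⟨K.addVertex (t ∘ σ), r⟩ ⟨K.addVertex t, r⟩ := by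
  refine ⟨Equiv.refl _, Equiv.sumCongr (Equiv.refl _) σ, fun f => ?_, rfl⟩
  cases f <;> exact (congrFun Sym2.map_id _).symm

/-! ### Mader operations preserve 4-edge-connectivity -/

theorem cross_le_cross_add_cross {α : Type} (X : Set (Option α)) (a b : α) :
    cross (some ⁻¹' X) s(a, b) ≤ cross X s(none, some a) + cross X s(none, some b) := by
  by_cases some a ∈ X <;> by_cases some b ∈ X <;> by_cases none ∈ X <;>
    simp [cross, crosses_mk, *]

theorem MG.FourEdgeConnected.insertEdge {G : MG} [Finite G.E] (h : G.FourEdgeConnected)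
    (p : Sym2 G.V) : (G.insertEdge p).FourEdgeConnected := by
  rw [fourEdgeConnected_iff_cutSize] at h ⊢
  refine ⟨h.1, fun X hX hX' => ?_⟩
  have := h.2 X hX hX'
  have := G.cutSize_insertEdge p X
  omega

theorem MG.FourEdgeConnected.addVertex {K : MG} [Finite K.V] [Finite K.E] {t : Fin 4 → K.V}
    (h : ((K.insertEdge s(t 0, t 1)).insertEdge s(t 2, t 3)).FourEdgeConnected) :
    (K.addVertex t).FourEdgeConnected := by
  rw [fourEdgeConnected_iff_cutSize] at h ⊢
  constructor
  · have h1 : 2 ≤ Nat.card K.V := h.1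
    have h2 : Nat.card (K.addVertex t).V = Nat.card K.V + 1 := Finite.card_option
    omega
  · intro (X : Set (Option K.V)) hX hX'
    have hcut := K.cutSize_addVertex t X
    rw [Fin.sum_univ_four] at hcut
    by_cases h0 : (some ⁻¹' X : Set K.V).Nonempty
    · by_cases h1 : (some ⁻¹' X : Set K.V) = Set.univ
      · have hs : ∀ a, some a ∈ X := fun a => Set.eq_univ_iff_forall.1 h1 a
        have hn : none ∉ X := fun hn =>
          hX' (Set.eq_univ_iff_forall.2 fun o => by cases o; exacts [hn, hs _])
        simp only [cross, crosses_mk, hs, hn] at hcut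
        simp at hcut
        omega
      · have h4 := h.2 (some ⁻¹' X) h0 h1
        have e1 := (K.insertEdge s(t 0, t 1)).cutSize_insertEdge s(t 2, t 3) (some ⁻¹' X)
        have e2 := K.cutSize_insertEdge s(t 0, t 1) (some ⁻¹' X)
        have e3 := cross_le_cross_add_cross X (t 0) (t 1)
        have e4 := cross_le_cross_add_cross X (t 2) (t 3)
        omega
    · have hs : ∀ a, some a ∉ X := fun a ha => h0 ⟨a, ha⟩
      obtain ⟨o, ho⟩ := hX
      have hn : none ∈ X := by cases o; exacts [ho, absurd ho (hs _)]
      simp only [cross, crosses_mk, hs, hn] at hcut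
      simp at hcut
      omega

/-- Delete two distinct edges. -/
abbrev MG.deleteTwo (G : MG) (e₁ e₂ : G.E) : MG :=
  ⟨G.V, {e : G.E // e ≠ e₁ ∧ e ≠ e₂}, fun e => G.ends e⟩

theorem MG.pinch_eq_addVertex (G : MG) (e₁ e₂ : G.E) (x y z w : G.V) :
    G.pinch e₁ e₂ x y z w = (G.deleteTwo e₁ e₂).addVertex ![x, y, z, w] := by
  unfold pinch addVertex deleteTwo
  congr
  ext e : 1
  rcases e with e | i
  · rfl
  · fin_cases i <;> rfl

theorem pIso_insertEdge_insertEdge_deleteTwo (G : MG) {e₁ e₂ : G.E} (hne : e₁ ≠ e₂) (r : G.V) :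
    PIso ⟨G, r⟩ ⟨((G.deleteTwo e₁ e₂).insertEdge (G.ends e₁)).insertEdge (G.ends e₂), r⟩ := by
  classical
  let f : Option (Option {e : G.E // e ≠ e₁ ∧ e ≠ e₂}) → G.E :=
    fun o => o.elim e₂ fun o => o.elim e₁ Subtype.val
  have hf : Function.Bijective f := by
    constructor
    · rintro (_ | _ | ⟨a, ha⟩) (_ | _ | ⟨b, hb⟩) hab <;> simp_all [f]
      · exact absurd hab.symm hb.2
      · exact absurd hab.symm hb.1
    · intro e
      by_cases h2 : e = e₂
      · exact ⟨none, h2.symm⟩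
      by_cases h1 : e = e₁
      · exact ⟨some none, h1.symm⟩
      · exact ⟨some (some ⟨e, h1, h2⟩), rfl⟩
  refine PIso.symm ⟨Equiv.refl _, Equiv.ofBijective f hf, fun o => ?_, rfl⟩
  rcases o with _ | _ | o <;> exact (congrFun Sym2.map_id _).symm

theorem MaderStep.preserves {P Q : PMG} (h : MaderStep P Q)
    (hP : Finite P.G.V ∧ Finite P.G.E ∧ P.G.FourEdgeConnected) :
    Finite Q.G.V ∧ Finite Q.G.E ∧ Q.G.FourEdgeConnected := by
  obtain ⟨_, _, hP⟩ := hP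
  cases h with
  | addEdge p =>
    exact ⟨inferInstanceAs (Finite P.G.V), inferInstanceAs (Finite (Option P.G.E)),
      hP.insertEdge p⟩
  | pinch e₁ e₂ x y z w hne h₁ h₂ =>
    have : Finite (P.G.deleteTwo e₁ e₂).V := inferInstanceAs (Finite P.G.V)
    have : Finite (P.G.deleteTwo e₁ e₂).E :=
      inferInstanceAs (Finite {e : P.G.E // e ≠ e₁ ∧ e ≠ e₂})
    simp only [pinch_eq_addVertex]
    refine ⟨inferInstance, inferInstance, FourEdgeConnected.addVertex ?_⟩
    have hiso := pIso_insertEdge_insertEdge_deleteTwo P.G hne P.r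
    rw [h₁, h₂] at hiso
    exact hiso.fourEdgeConnected hP

theorem basePMG_fourEdgeConnected : basePMG.G.FourEdgeConnected := by
  have : Finite basePMG.G.E := inferInstanceAs (Finite (Fin 4))
  rw [fourEdgeConnected_iff_cutSize]
  refine ⟨by simp [basePMG], fun (X : Set Bool) hX hX' => ?_⟩
  have hc : Crosses X s(false, true) := by
    rw [crosses_mk]
    by_contra hcon
    obtain ⟨b, hb⟩ := hX
    refine hX' (Set.eq_univ_iff_forall.2 fun c => ?_)
    cases b <;> cases c <;> tauto
  have : {e : Fin 4 | Crosses X s(false, true)} = Set.univ := by simp [hc]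
  change 4 ≤ {e : Fin 4 | Crosses X s(false, true)}.ncard
  rw [this, Set.ncard_univ, Nat.card_fin]

theorem MaderConstructible.fourEdgeConnected {G : MG} [Finite G.E] {r : G.V}
    (h : MaderConstructible G r) : G.FourEdgeConnected := by
  obtain ⟨Q, hQ, hiso⟩ := h
  have hfour : Finite Q.G.V ∧ Finite Q.G.E ∧ Q.G.FourEdgeConnected := by
    clear hiso
    induction hQ with
    | refl =>
      exact ⟨inferInstanceAs (Finite Bool), inferInstanceAs (Finite (Fin 4)),
        basePMG_fourEdgeConnected⟩
    | tail _ hstep ih => exact hstep.preserves ih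
  obtain ⟨_, _, hfour⟩ := hfour
  have : Finite (⟨G, r⟩ : PMG).G.E := ‹Finite G.E›
  exact hiso.fourEdgeConnected hfour

/-! ### Closure of constructibility under isomorphisms and Mader operations -/

theorem MaderConstructible.of_pIso {G H : MG} {r : G.V} {r' : H.V} (h : MaderConstructible H r')
    (hiso : PIso ⟨H, r'⟩ ⟨G, r⟩) : MaderConstructible G r := by
  obtain ⟨Q, hQ, hQH⟩ := h
  exact ⟨Q, hQ, hQH.trans hiso⟩

theorem MaderConstructible.insertEdge {G : MG} {r : G.V} (h : MaderConstructible G r)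
    (p : Sym2 G.V) : MaderConstructible (G.insertEdge p) r := by
  obtain ⟨Q, hQ, fV, fE, hends, hr⟩ := h
  refine ⟨_, hQ.tail (MaderStep.addEdge Q (p.map fV.symm)), fV, Equiv.optionCongr fE, ?_, hr⟩
  rintro (_ | e)
  · change p = (p.map fV.symm).map fV
    simp [Sym2.map_map]
  · exact hends e

theorem MaderConstructible.addVertex {K : MG} {r : K.V} {t : Fin 4 → K.V}
    (h : MaderConstructible ((K.insertEdge s(t 0, t 1)).insertEdge s(t 2, t 3)) r) :
    MaderConstructible (K.addVertex t) (some r) := by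
  obtain ⟨Q, hQ, fV, fE, hends, hr⟩ := h
  let u : Fin 4 → Q.G.V := fun i => fV.symm (t i)
  have hends' : ∀ f, Q.G.ends (fE.symm f) =
      (((K.insertEdge s(t 0, t 1)).insertEdge s(t 2, t 3)).ends f).map fV.symm := by
    intro f
    obtain ⟨e, rfl⟩ := fE.surjective f
    rw [hends, Sym2.map_map]
    simp
  have h₁ : Q.G.ends (fE.symm (some none)) = s(u 0, u 1) := hends' _
  have h₂ : Q.G.ends (fE.symm none) = s(u 2, u 3) := hends' _
  have hne : fE.symm (some none) ≠ fE.symm none := by simp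
  refine ⟨_, hQ.tail (MaderStep.pinch Q _ _ _ _ _ _ hne h₁ h₂), PIso.symm ?_⟩
  let g : K.E → {e : Q.G.E // e ≠ fE.symm (some none) ∧ e ≠ fE.symm none} :=
    fun e => ⟨fE.symm (some (some e)), by simp, by simp⟩
  have hg : Function.Bijective g := by
    constructor
    · intro a b hab
      simpa [g] using hab
    · rintro ⟨e, he1, he2⟩
      obtain ⟨f, rfl⟩ := fE.symm.surjective e
      rcases f with _ | _ | f
      · exact absurd rfl he2
      · exact absurd rfl he1
      · exact ⟨f, rfl⟩
  refine ⟨Equiv.optionCongr fV.symm,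
    Equiv.sumCongr (Equiv.ofBijective g hg) (Equiv.refl _), ?_, ?_⟩
  · rintro (e | i)
    · change (Q.G.ends (fE.symm (some (some e)))).map some = ((K.ends e).map some).map _
      rw [hends', Sym2.map_map]
      exact (Sym2.map_map (f := some) (g := fV.symm.optionCongr) (K.ends e)).symm
    · fin_cases i <;> rfl
  · change some (fV.symm r) = some Q.r
    exact congrArg some ((Equiv.symm_apply_eq fV).2 hr.symm)

/-! ### Splitting off a vertex of degree four -/

open Classical in
theorem exists_splitting (K : MG) [Finite K.E] (t : Fin 4 → K.V)
    (h : ∀ X : Set K.V, X.Nonempty → 4 ≤ K.cutSize X + ∑ i, if t i ∈ X then 1 else 0) :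
    ∃ σ : Equiv.Perm (Fin 4), ∀ X : Set K.V, X.Nonempty → X ≠ Set.univ →
      4 ≤ K.cutSize X + cross X s(t (σ 0), t (σ 1)) + cross X s(t (σ 2), t (σ 3)) := by
  have key : ∀ σ : Equiv.Perm (Fin 4), (∃ X : Set K.V, X.Nonempty ∧ X ≠ Set.univ ∧
      K.cutSize X + cross X s(t (σ 0), t (σ 1)) + cross X s(t (σ 2), t (σ 3)) < 4) →
      ∃ X : Set K.V, K.cutSize X ≤ 3 ∧
        t (σ 0) ∈ X ∧ t (σ 1) ∈ X ∧ t (σ 2) ∉ X ∧ t (σ 3) ∉ X := by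
    rintro σ ⟨X, hX, hX', hlt⟩
    have h1 := h X hX
    have h2 := h Xᶜ (Set.nonempty_compl.2 hX')
    rw [← Equiv.sum_comp σ, Fin.sum_univ_four] at h1 h2
    have hc := K.cutSize_compl X
    by_cases m0 : t (σ 0) ∈ X <;> by_cases m1 : t (σ 1) ∈ X <;>
      by_cases m2 : t (σ 2) ∈ X <;> by_cases m3 : t (σ 3) ∈ X <;>
      simp [cross, crosses_mk, m0, m1, m2, m3] at h1 h2 hlt <;>
      first
        | omega
        | exact ⟨X, by omega, m0, m1, m2, m3⟩
        | exact ⟨Xᶜ, by omega, m0, m1, by simpa using m2, by simpa using m3⟩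
  by_contra! hcon
  obtain ⟨X, hX, x0, x1, x2, x3⟩ := key _ (hcon 1)
  obtain ⟨Y, hY, y0, y2, y1, y3⟩ := key _ (hcon (Equiv.swap 1 2))
  have s0 : Equiv.swap (1 : Fin 4) 2 0 = 0 := by decide
  have s1 : Equiv.swap (1 : Fin 4) 2 1 = 2 := by decide
  have s2 : Equiv.swap (1 : Fin 4) 2 2 = 1 := by decide
  have s3 : Equiv.swap (1 : Fin 4) 2 3 = 3 := by decide
  simp only [s0, s1, s2, s3, Equiv.Perm.coe_one, id] at x0 x1 x2 x3 y0 y1 y2 y3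
  have hA := h (X ∩ Y) ⟨_, x0, y0⟩
  have hB := h (X ∩ Yᶜ) ⟨_, x1, y1⟩
  have hC := h (Xᶜ ∩ Y) ⟨_, x2, y2⟩
  have hD := h (Xᶜ ∩ Yᶜ) ⟨_, x3, y3⟩
  rw [Fin.sum_univ_four] at hA hB hC hD
  simp [x0, x1, x2, x3, y0, y1, y2, y3] at hA hB hC hD
  have hAD := K.cutSize_inter_add_cutSize_compl_inter_compl_le X Y
  have hBC := K.cutSize_inter_add_cutSize_compl_inter_compl_le X Yᶜ
  have hev := K.even_cutSize_inter_add_cutSize_inter_compl_add X Y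
  rw [compl_compl, K.cutSize_compl Y] at hBC
  rw [Nat.even_iff] at hev
  omega

theorem exists_fourEdgeConnected_of_addVertex (K : MG) [Finite K.V] [Finite K.E]
    (t : Fin 4 → K.V) (hcard : 2 ≤ Nat.card K.V) (h : (K.addVertex t).FourEdgeConnected) :
    ∃ σ : Equiv.Perm (Fin 4),
      ((K.insertEdge s(t (σ 0), t (σ 1))).insertEdge s(t (σ 2), t (σ 3))).FourEdgeConnected := by
  classical
  obtain ⟨σ, hσ⟩ := exists_splitting K t fun X hX => by
    have h4 := h.four_le_cutSize (X := some '' X) (hX.image _)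
      fun hu => by simpa using Set.eq_univ_iff_forall.1 hu none
    rw [cutSize_addVertex, Set.preimage_image_eq _ (Option.some_injective _)] at h4
    convert h4 using 4 with i
    simp [cross, crosses_mk]
  refine ⟨σ, ?_⟩
  rw [fourEdgeConnected_iff_cutSize]
  refine ⟨hcard, fun X hX hX' => ?_⟩
  rw [cutSize_insertEdge, cutSize_insertEdge]
  exact hσ X hX hX'

/-! ### Minimally 4-edge-connected graphs -/

/-- A 4-edge-connected graph none of whose edges can be deleted without destroying
4-edge-connectivity. -/
def MG.MinimallyFourEdgeConnected (G : MG) : Prop :=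
  G.FourEdgeConnected ∧ ∀ e, ¬ (G.deleteEdge e).FourEdgeConnected

theorem MG.MinimallyFourEdgeConnected.exists_tight {G : MG} [Finite G.E]
    (h : G.MinimallyFourEdgeConnected) (r : G.V) (e : G.E) :
    ∃ X : Set G.V, r ∉ X ∧ G.cutSize X = 4 ∧ Crosses X (G.ends e) := by
  have hX : ∃ X : Set G.V, G.cutSize X = 4 ∧ Crosses X (G.ends e) := by
    have hdel := h.2 e
    rw [fourEdgeConnected_iff_cutSize] at hdel
    have hcard : 2 ≤ Nat.card (G.deleteEdge e).V := h.1.1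
    push Not at hdel
    obtain ⟨X, hX, hX', hlt⟩ := hdel hcard
    have h4 : 4 ≤ G.cutSize X := h.1.four_le_cutSize hX hX'
    have hadd := G.cutSize_deleteEdge_add e X
    refine ⟨X, ?_⟩
    by_cases hc : Crosses X (G.ends e)
    · simp only [cross, hc, if_true] at hadd
      exact ⟨by omega, hc⟩
    · simp only [cross, hc, if_false] at hadd
      omega
  obtain ⟨X, h4, hc⟩ := hX
  by_cases hr : r ∈ X
  · refine ⟨Xᶜ, by simpa, by rw [cutSize_compl, h4], ?_⟩
    exact ⟨hc.2, hc.1.imp fun a ha => ⟨ha.1, fun hn => hn ha.2⟩⟩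
  · exact ⟨X, hr, h4, hc⟩

theorem MG.MinimallyFourEdgeConnected.ends_ne_diag {G : MG} [Finite G.E]
    (h : G.MinimallyFourEdgeConnected) (e : G.E) (v : G.V) : G.ends e ≠ s(v, v) := by
  intro he
  obtain ⟨X, -, -, hc⟩ := h.exists_tight v e
  rw [he, crosses_mk] at hc
  tauto

theorem MG.FourEdgeConnected.exists_edge_inside {G : MG} [Finite G.E] (h : G.FourEdgeConnected)
    {X : Set G.V} (h4 : G.cutSize X = 4) {r u v : G.V} (hr : r ∉ X) (hu : u ∈ X) (hv : v ∈ X)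
    (huv : v ≠ u) : ∃ e a b, G.ends e = s(a, b) ∧ a ∈ X ∧ b ∈ X ∧ a ≠ b := by
  by_contra! hcon
  have h1 := h.four_le_cutSize (X := {u}) ⟨u, rfl⟩
    fun hU => hr ((Set.eq_univ_iff_forall.1 hU r : r = u) ▸ hu)
  have h2 := h.four_le_cutSize (X := X \ {u}) ⟨v, hv, huv⟩
    fun hU => hr (Set.eq_univ_iff_forall.1 hU r).1
  have hle : G.cutSize {u} + G.cutSize (X \ {u}) ≤ G.cutSize X := by
    cases nonempty_fintype G.E
    simp only [cutSize_eq_sum, ← Finset.sum_add_distrib]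
    refine Finset.sum_le_sum fun e _ => ?_
    have hin := hcon e
    revert hin
    induction G.ends e with
    | _ a b =>
      intro hin
      have hin := hin a b rfl
      by_cases haX : a ∈ X <;> by_cases hbX : b ∈ X
      · obtain rfl := hin haX hbX
        simp [cross, crosses_mk]
      · have hbu : b ≠ u := fun hh => hbX (hh ▸ hu)
        by_cases a = u <;> simp [cross, crosses_mk, *]
      · have hau : a ≠ u := fun hh => haX (hh ▸ hu)
        by_cases b = u <;> simp [cross, crosses_mk, *]
      · simp [cross, crosses_mk, haX, hbX, (ne_of_mem_of_not_mem hu haX).symm,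
          (ne_of_mem_of_not_mem hu hbX).symm]
  omega

theorem MG.MinimallyFourEdgeConnected.exists_cutSize_singleton {G : MG} [Finite G.V]
    [Finite G.E] (h : G.MinimallyFourEdgeConnected) (r : G.V) :
    ∃ s, s ≠ r ∧ G.cutSize {s} = 4 := by
  have hex : ∃ X : Set G.V, X.Nonempty ∧ r ∉ X ∧ G.cutSize X = 4 := by
    have hne : ({r} : Set G.V) ≠ Set.univ := by
      intro hU
      have hc := h.1.1
      rw [← Set.ncard_univ, ← hU, Set.ncard_singleton] at hc
      omega
    have h4 := h.1.four_le_cutSize (Set.singleton_nonempty r) hne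
    obtain ⟨e, -⟩ := Set.nonempty_of_ncard_ne_zero (show G.cutSize {r} ≠ 0 by omega)
    obtain ⟨X, hr, h4, hc⟩ := h.exists_tight r e
    exact ⟨X, hc.1.imp fun a ha => ha.2, hr, h4⟩
  obtain ⟨X, ⟨hX, hr, h4⟩, hmin⟩ :=
    exists_minimal_of_wellFoundedLT
      (fun X : Set G.V => X.Nonempty ∧ r ∉ X ∧ G.cutSize X = 4) hex
  obtain ⟨u, hu⟩ := hX
  by_cases hsub : ∀ v ∈ X, v = u
  · have hXu : X = {u} := Set.eq_singleton_iff_unique_mem.2 ⟨hu, hsub⟩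
    exact ⟨u, fun hur => hr (hur ▸ hu), hXu ▸ h4⟩
  push Not at hsub
  obtain ⟨v, hv, hvu⟩ := hsub
  obtain ⟨e, a, b, he, ha, hb, -⟩ := h.1.exists_edge_inside h4 hr hu hv hvu
  obtain ⟨Y, hrY, h4Y, hc⟩ := h.exists_tight r e
  have hne : ∀ Z : Set G.V, r ∉ Z → Z ≠ Set.univ := fun Z hZ hU => hZ (hU ▸ Set.mem_univ r)
  obtain ⟨c, d, hcX, hdX, hcY, hdY⟩ : ∃ c d, c ∈ X ∧ d ∈ X ∧ c ∈ Y ∧ d ∉ Y := by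
    rw [he, crosses_mk] at hc
    rcases hc with ⟨h1, h2⟩ | ⟨h1, h2⟩
    exacts [⟨a, b, ha, hb, h1, h2⟩, ⟨b, a, hb, ha, h2, h1⟩]
  have hI := h.1.four_le_cutSize (X := X ∩ Y) ⟨c, hcX, hcY⟩ (hne _ fun hh => hr hh.1)
  have hU := h.1.four_le_cutSize (X := X ∪ Y) ⟨c, Or.inl hcX⟩
    (hne _ fun hh => hh.elim hr hrY)
  have hsm := G.cutSize_inter_add_cutSize_union_le X Y
  have hle : X ≤ X ∩ Y :=
    hmin ⟨⟨c, hcX, hcY⟩, fun hh => hr hh.1, by omega⟩ Set.inter_subset_left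
  exact absurd (hle hdX).2 hdY

/-! ### Construction of 4-edge-connected graphs -/

theorem Sym2.exists_map_val_eq {α : Type} {P : α → Prop} (p : Sym2 α) (h : ∀ a ∈ p, P a) :
    ∃ q : Sym2 {a // P a}, q.map Subtype.val = p := by
  induction p with
  | _ a b => exact ⟨s(⟨a, h a (by simp)⟩, ⟨b, h b (by simp)⟩), rfl⟩

theorem exists_pIso_addVertex (G : MG) [Finite G.V] [Finite G.E] {r s : G.V} (hs : s ≠ r)
    (hloop : ∀ e, G.ends e ≠ s(s, s)) (h4 : G.cutSize {s} = 4) :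
    ∃ (K : MG) (r' : K.V) (t : Fin 4 → K.V), Finite K.V ∧ Finite K.E ∧
      Nat.card K.V + 1 = Nat.card G.V ∧ Nat.card K.E + 4 = Nat.card G.E ∧
      PIso ⟨K.addVertex t, some r'⟩ ⟨G, r⟩ := by
  classical
  have hends : ∀ e : {e : G.E // s ∉ G.ends e}, ∃ q : Sym2 {v : G.V // v ≠ s},
      q.map Subtype.val = G.ends e := fun e =>
    Sym2.exists_map_val_eq _ fun a ha has => e.2 (has ▸ ha)
  choose q hq using hends
  have hother : ∀ e : {e : G.E // s ∈ G.ends e}, ∃ v : {v : G.V // v ≠ s},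
      G.ends e = s(s, v.1) := by
    rintro ⟨e, he⟩
    obtain ⟨v, hv⟩ := Sym2.mem_iff_exists.1 he
    exact ⟨⟨v, fun hvs => hloop e (hvs ▸ hv)⟩, hv⟩
  choose o ho using hother
  have hcard : Nat.card {e : G.E // s ∈ G.ends e} = 4 := by
    rw [← h4, cutSize, ← Nat.card_coe_set_eq]
    refine Nat.card_congr (Equiv.subtypeEquivRight fun e => ?_)
    constructor
    · intro he
      simp [ho ⟨e, he⟩, crosses_mk, (o ⟨e, he⟩).2]
    · rintro ⟨⟨a, ha, rfl⟩, -⟩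
      exact ha
  let φ : Fin 4 ≃ {e : G.E // s ∈ G.ends e} := (Finite.equivFinOfCardEq hcard).symm
  let ψ : {e : G.E // s ∉ G.ends e} ⊕ Fin 4 ≃ G.E :=
    (Equiv.sumCongr (Equiv.refl _) φ).trans
      ((Equiv.sumComm _ _).trans (Equiv.sumCompl fun e => s ∈ G.ends e))
  refine ⟨⟨{v : G.V // v ≠ s}, {e : G.E // s ∉ G.ends e}, q⟩, ⟨r, hs.symm⟩,
    fun i => o (φ i), inferInstanceAs (Finite {v : G.V // v ≠ s}),
    inferInstanceAs (Finite {e : G.E // s ∉ G.ends e}), ?_, ?_,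
    Equiv.optionSubtypeNe s, ψ, ?_, rfl⟩
  · rw [← Nat.card_congr (Equiv.optionSubtypeNe s), Finite.card_option]
  · rw [← Nat.card_congr ψ, Nat.card_sum, Nat.card_fin]
  · rintro (e | i)
    · change G.ends e = ((q e).map some).map _
      rw [← hq e, Sym2.map_map]
      rfl
    · exact ho (φ i)

theorem MG.MinimallyFourEdgeConnected.pIso_basePMG {G : MG} [Finite G.V] [Finite G.E]
    (h : G.MinimallyFourEdgeConnected) (hcard : Nat.card G.V = 2) (r : G.V) :
    PIso basePMG ⟨G, r⟩ := by
  classical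
  obtain ⟨s, hs, h4⟩ := h.exists_cutSize_singleton r
  have huniv : ∀ v, v = r ∨ v = s := by
    have : ({r, s} : Set G.V) = Set.univ :=
      (Set.eq_univ_iff_ncard _).2 (by rw [Set.ncard_pair hs.symm, hcard])
    intro v
    simpa using Set.eq_univ_iff_forall.1 this v
  have hends : ∀ e, G.ends e = s(r, s) := by
    intro e
    have hr := h.ends_ne_diag e r
    have hs' := h.ends_ne_diag e s
    revert hr hs'
    induction G.ends e with
    | _ a b =>
      rcases huniv a with rfl | rfl <;> rcases huniv b with rfl | rfl <;> simp
  have hE : Nat.card G.E = 4 := by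
    rw [← h4, cutSize, ← Set.ncard_univ]
    congr 1
    ext e
    simp [hends, crosses_mk, hs.symm]
  have hbij : Function.Bijective fun b : Bool => if b then s else r := by
    constructor
    · rintro (_ | _) (_ | _) <;> simp [hs, hs.symm]
    · intro v
      rcases huniv v with rfl | rfl
      exacts [⟨false, rfl⟩, ⟨true, rfl⟩]
  exact ⟨Equiv.ofBijective _ hbij, (Finite.equivFinOfCardEq hE).symm,
    fun e => hends _, rfl⟩

theorem MG.FourEdgeConnected.maderConstructible {G : MG} [Finite G.V] [Finite G.E]
    (h : G.FourEdgeConnected) (r : G.V) : MaderConstructible G r := by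
  induction hn : Nat.card G.V + Nat.card G.E using Nat.strong_induction_on generalizing G with
  | _ n ih =>
  by_cases hdel : ∃ e, (G.deleteEdge e).FourEdgeConnected
  · obtain ⟨e, he⟩ := hdel
    have hlt : Nat.card (G.deleteEdge e).E < Nat.card G.E :=
      Finite.card_subtype_lt (x := e) (by simp)
    have hV : Nat.card (G.deleteEdge e).V = Nat.card G.V := rfl
    exact ((ih _ (by omega) he r rfl).insertEdge (G.ends e)).of_pIso
      (pIso_insertEdge_deleteEdge G e r)
  · push Not at hdel
    have hmin : G.MinimallyFourEdgeConnected := ⟨h, hdel⟩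
    by_cases hcard : Nat.card G.V = 2
    · exact ⟨basePMG, Relation.ReflTransGen.refl, hmin.pIso_basePMG hcard r⟩
    obtain ⟨s, hs, h4⟩ := hmin.exists_cutSize_singleton r
    obtain ⟨K, r', t, _, _, hKV, hKE, hiso⟩ :=
      exists_pIso_addVertex G hs (fun e => hmin.ends_ne_diag e s) h4
    have h2 := h.1
    have : Finite (⟨G, r⟩ : PMG).G.E := ‹Finite G.E›
    have : Finite (⟨K.addVertex t, some r'⟩ : PMG).G.E :=
      inferInstanceAs (Finite (K.addVertex t).E)
    obtain ⟨σ, hσ⟩ := exists_fourEdgeConnected_of_addVertex K t (by omega)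
      (hiso.symm.fourEdgeConnected h)
    have hE : Nat.card ((K.insertEdge s(t (σ 0), t (σ 1))).insertEdge s(t (σ 2), t (σ 3))).E
        = Nat.card K.E + 1 + 1 :=
      Finite.card_option.trans (congrArg (· + 1) Finite.card_option)
    have hV : Nat.card ((K.insertEdge s(t (σ 0), t (σ 1))).insertEdge s(t (σ 2), t (σ 3))).V
        = Nat.card K.V := rfl
    have hH := ih _ (by omega) hσ r' rfl
    exact (MaderConstructible.addVertex (t := t ∘ σ) hH).of_pIso
      ((pIso_addVertex_comp_perm K t σ _).trans hiso)

theorem mader_construction (G : MG) [Finite G.V] [Finite G.E] :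
    G.FourEdgeConnected ↔ (Nonempty G.V ∧ ∀ r : G.V, MaderConstructible G r) := by
  constructor
  · intro h
    have hcard := h.1
    exact ⟨(Nat.card_pos_iff.1 (by omega)).1, h.maderConstructible⟩
  · rintro ⟨⟨r⟩, h⟩
    exact (h r).fourEdgeConnected
end

section
/- Suppose G is a multigraph in which every vertex other than r is incident to at least one edge, and G has a chain decomposition rooted at r. If G' is obtained from G by adding a new edge between two (not necessarily distinct) vertices of G, then G' has a chain decomposition rooted at r. -/
set_option autoImplicit false

namespace MG

variable {G : MG}

theorem IsLink.mem_of_mem_ends {w : G.V} {e : G.E} :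
    ∀ {vs : List G.V} {es : List G.E}, G.IsLink vs es → e ∈ es → w ∈ G.ends e → w ∈ vs
  | [_], [], _, he, _ => by simp at he
  | a :: b :: vs, e' :: es, h, he, hw => by
    rcases List.mem_cons.1 he with rfl | he
    · rw [h.1, Sym2.mem_iff] at hw
      rcases hw with rfl | rfl <;> simp
    · exact List.mem_cons_of_mem _ (h.2.mem_of_mem_ends he hw)
  | [], _, h, _, _ => by simp [IsLink] at h
  | [_], _ :: _, h, _, _ => by simp [IsLink] at h
  | _ :: _ :: _, [], h, _, _ => by simp [IsLink] at h

theorem IsUpChain.two_le_deg {r w : G.V} {H Hb C : Set G.E} (h : G.IsUpChain r H Hb C)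
    (hr : w ≠ r) (hw : w ∈ G.vertsOf C) : 2 ≤ G.deg Hb w := by
  obtain ⟨e, he, hwe⟩ := hw
  rcases h with ⟨-, -, vs, es, hp, -, rfl, hdeg, -⟩ | ⟨v, -, -, vs, es, hc, rfl, hdeg, -⟩
  · exact (hdeg w (hp.2.2.mem_of_mem_ends he hwe)).resolve_left hr
  · refine (hdeg w ?_).resolve_left hr
    have := hc.2.2.2.mem_of_mem_ends he hwe
    simp only [List.mem_cons, List.mem_append, List.not_mem_nil, or_false] at this ⊢
    tauto

/-- A non-root vertex of a chain has degree at least two before it or after it. -/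
theorem IsChain.two_le_deg {r w : G.V} {H Hb C : Set G.E} (h : G.IsChain r H Hb C)
    (hr : w ≠ r) (hw : w ∈ G.vertsOf C) : 2 ≤ G.deg H w ∨ 2 ≤ G.deg Hb w := by
  rcases h with h | h | ⟨u, v, e, -, -, rfl, he, hu, hv⟩
  · exact .inr (h.two_le_deg hr hw)
  · exact .inl (IsUpChain.two_le_deg h hr hw)
  · obtain ⟨_, rfl, hwe⟩ := hw
    rw [he, Sym2.mem_iff] at hwe
    rcases hwe with rfl | rfl
    · exact .inl (hu.resolve_left hr)
    · exact .inr (hv.resolve_left hr)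

theorem deg_mono [Finite G.E] {F F' : Set G.E} (h : F ⊆ F') (v : G.V) :
    G.deg F v ≤ G.deg F' v :=
  add_le_add (Set.ncard_le_ncard fun _ he => ⟨h he.1, he.2⟩)
    (Set.ncard_le_ncard fun _ he => ⟨h he.1, he.2⟩)

section Map

variable {E' : Type} {ends' : E' → Sym2 G.V} {f : G.E → E'}

theorem IsLink.map (hends : ∀ e, ends' (f e) = G.ends e) :
    ∀ {vs : List G.V} {es : List G.E}, G.IsLink vs es →
      (MG.mk G.V E' ends').IsLink vs (es.map f)
  | [_], [], _ => trivial
  | _ :: _ :: _, _ :: _, h => ⟨(hends _).trans h.1, h.2.map hends⟩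
  | [], _, h => by simp [IsLink] at h
  | [_], _ :: _, h => by simp [IsLink] at h
  | _ :: _ :: _, [], h => by simp [IsLink] at h

theorem deg_le_deg_of_image_subset [Finite E'] (hf : f.Injective)
    (hends : ∀ e, ends' (f e) = G.ends e) {F : Set G.E} {F' : Set E'} (h : f '' F ⊆ F')
    (v : G.V) : G.deg F v ≤ (MG.mk G.V E' ends').deg F' v := by
  refine add_le_add ?_ ?_
  all_goals
    rw [← Set.ncard_image_of_injective _ hf]
    refine Set.ncard_le_ncard ?_
    rintro _ ⟨e, ⟨he, hv⟩, rfl⟩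
    exact ⟨h ⟨e, he, rfl⟩, by simpa only [hends] using hv⟩

theorem vertsOf_subset_of_image_subset (hends : ∀ e, ends' (f e) = G.ends e)
    {F : Set G.E} {F' : Set E'} (h : f '' F ⊆ F') :
    G.vertsOf F ⊆ (MG.mk G.V E' ends').vertsOf F' := by
  rintro v ⟨e, he, hv⟩
  exact ⟨f e, h ⟨e, he, rfl⟩, by simpa only [hends] using hv⟩

variable [Finite E'] {r : G.V} {H Hb C : Set G.E} {H' Hb' : Set E'}

theorem IsUpChain.map (h : G.IsUpChain r H Hb C) (hf : f.Injective)
    (hends : ∀ e, ends' (f e) = G.ends e) (hH : f '' H ⊆ H') (hHb : f '' Hb ⊆ Hb')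
    (hCH : Disjoint (f '' C) H') (hCHb : Disjoint (f '' C) Hb') :
    (MG.mk G.V E' ends').IsUpChain r H' Hb' (f '' C) := by
  have dH := deg_le_deg_of_image_subset hf hends hH
  have dHb := deg_le_deg_of_image_subset hf hends hHb
  have vH := vertsOf_subset_of_image_subset hends hH
  rcases h with ⟨-, -, vs, es, hp, hne, rfl, hdeg, hh, hl⟩ |
    ⟨v, -, -, vs, es, hc, rfl, hdeg, hv⟩
  · refine .inl ⟨hCH, hCHb, vs, es.map f, ⟨hp.1, hp.2.1.map hf, hp.2.2.map hends⟩,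
      by simpa using hne, by ext; simp, fun v hv => ?_, fun v hv => ?_, fun v hv => ?_⟩
    · exact (hdeg v hv).imp_right fun h => h.trans (dHb v)
    · exact (hh v hv).imp_right fun h => vH h
    · exact (hl v hv).imp_right fun h => vH h
  · refine .inr ⟨v, hCH, hCHb, vs, es.map f,
      ⟨hc.1, hc.2.1.map hf, by simpa using hc.2.2.1, hc.2.2.2.map hends⟩,
      by ext; simp, fun v hv => ?_, ?_⟩
    · exact (hdeg v hv).imp_right fun h => h.trans (dHb v)
    · exact hv.imp_right fun h => h.trans (dH v)

/-- A chain remains a chain after enlarging the edge set of the graph and the two sides. -/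
theorem IsChain.map (h : G.IsChain r H Hb C) (hf : f.Injective)
    (hends : ∀ e, ends' (f e) = G.ends e) (hH : f '' H ⊆ H') (hHb : f '' Hb ⊆ Hb')
    (hCH : Disjoint (f '' C) H') (hCHb : Disjoint (f '' C) Hb') :
    (MG.mk G.V E' ends').IsChain r H' Hb' (f '' C) := by
  rcases h with h | h | ⟨u, v, e, -, -, rfl, he, hu, hv⟩
  · exact .inl (h.map hf hends hH hHb hCH hCHb)
  · exact .inr (.inl (IsUpChain.map h hf hends hHb hH hCHb hCH))
  · rw [Set.image_singleton] at hCH hCHb ⊢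
    exact .inr (.inr ⟨u, v, f e, Set.disjoint_singleton_left.1 hCH,
      Set.disjoint_singleton_left.1 hCHb, rfl, (hends e).trans he,
      hu.imp_right fun h => h.trans (deg_le_deg_of_image_subset hf hends hH u),
      hv.imp_right fun h => h.trans (deg_le_deg_of_image_subset hf hends hHb v)⟩)

end Map

/-- In a chain decomposition every non-isolated vertex is either the root or has, at some cut
of the sequence of chains, degree at least two on both sides. -/
theorem IsChainDecomp.exists_cut [Finite G.E] {r : G.V} {n : ℕ} {Gs : Fin n → Set G.E}
    (h : G.IsChainDecomp r Gs) (w : G.V) (hw : w ≠ r → ∃ e : G.E, w ∈ G.ends e) :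
    ∃ k : Fin (n + 1), (w = r ∨ 2 ≤ G.deg {e | ∃ j : Fin n, j.castSucc < k ∧ e ∈ Gs j} w) ∧
      (w = r ∨ 2 ≤ G.deg {e | ∃ j : Fin n, k ≤ j.castSucc ∧ e ∈ Gs j} w) := by
  classical
  by_cases hr : w = r
  · exact ⟨0, .inl hr, .inl hr⟩
  obtain ⟨-, hcover, hchain⟩ := h
  have hmem (e : G.E) : ∃ i, e ∈ Gs i := by
    simpa using (hcover ▸ Set.mem_univ e : e ∈ ⋃ i, Gs i)
  let pre (k : ℕ) : Set G.E := {e | ∃ j : Fin n, (j : ℕ) < k ∧ e ∈ Gs j}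
  have hex : ∃ k, 2 ≤ G.deg (pre k) w := by
    refine ⟨n, ?_⟩
    obtain ⟨e, he⟩ := hw hr
    obtain ⟨i, hi⟩ := hmem e
    have huniv (F : Set G.E) : F ⊆ pre n := fun e _ =>
      let ⟨j, hj⟩ := hmem e
      ⟨j, j.2, hj⟩
    rcases (hchain i).two_le_deg hr ⟨e, hi, he⟩ with h | h <;>
      exact h.trans (deg_mono (huniv _) w)
  have hspec : 2 ≤ G.deg (pre (Nat.find hex)) w := Nat.find_spec hex
  have hmin : ∀ l < Nat.find hex, ¬ 2 ≤ G.deg (pre l) w := fun l hl => Nat.find_min hex hl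
  generalize Nat.find hex = k at hspec hmin
  obtain _ | k := k
  · simp [pre, deg] at hspec
  have hlt := hmin k k.lt_succ_self
  have hkn : k < n := by
    by_contra hkn
    refine hlt (hspec.trans (deg_mono ?_ w))
    rintro e ⟨j, -, hj⟩
    exact ⟨j, by omega, hj⟩
  have hwk : w ∈ G.vertsOf (Gs ⟨k, hkn⟩) := by
    by_contra hwk
    have hback : ∀ e ∈ pre (k + 1), w ∈ G.ends e → e ∈ pre k := by
      rintro e ⟨j, hj, he⟩ hwe
      rcases Nat.lt_succ_iff_lt_or_eq.1 hj with hj | rfl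
      · exact ⟨j, hj, he⟩
      · exact absurd ⟨e, he, hwe⟩ hwk
    refine hlt (hspec.trans (add_le_add (Set.ncard_le_ncard ?_) (Set.ncard_le_ncard ?_)))
    · exact fun e he => ⟨hback e he.1 he.2, he.2⟩
    · exact fun e he => ⟨hback e he.1 (he.2 ▸ Sym2.mem_mk_left w w), he.2⟩
  refine ⟨⟨k + 1, by omega⟩, .inr hspec, .inr ?_⟩
  exact ((hchain ⟨k, hkn⟩).two_le_deg hr hwk).resolve_left hlt

/-- A new edge `uv` may be inserted as a one-way chain at a cut where `u` has degree at least
two on the lower side and `v` on the upper side. -/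
theorem IsChainDecomp.hasChainDecomp_addEdge [Finite G.E] {r u v : G.V} {m : ℕ}
    {Gs : Fin (m + 1) → Set G.E} (h : G.IsChainDecomp r Gs) (k : Fin (m + 2))
    (hu : u = r ∨ 2 ≤ G.deg {e | ∃ j : Fin (m + 1), j.castSucc < k ∧ e ∈ Gs j} u)
    (hv : v = r ∨ 2 ≤ G.deg {e | ∃ j : Fin (m + 1), k ≤ j.castSucc ∧ e ∈ Gs j} v) :
    (G.addEdge s(u, v)).HasChainDecomp r := by
  let ends' : Option G.E → Sym2 G.V := fun e => e.elim s(u, v) G.ends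
  change (MG.mk G.V (Option G.E) ends').HasChainDecomp r
  obtain ⟨hdisj, hcover, hchain⟩ := h
  have hinj : (some : G.E → Option G.E).Injective := Option.some_injective _
  have hends : ∀ e, ends' (some e) = G.ends e := fun _ => rfl
  let Gs' : Fin (m + 2) → Set (Option G.E) := k.insertNth {none} fun i => some '' Gs i
  have hk : Gs' k = {none} := Fin.insertNth_apply_same (α := fun _ => Set (Option G.E)) k _ _
  have hs (i) : Gs' (k.succAbove i) = some '' Gs i :=
    Fin.insertNth_apply_succAbove (α := fun _ => Set (Option G.E)) k _ _ i
  have hdisj' : ∀ i j, i ≠ j → Disjoint (Gs' i) (Gs' j) := by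
    intro i j hij
    cases i using k.succAboveCases with
    | x =>
      cases j using k.succAboveCases with
      | x => exact absurd rfl hij
      | p j => simp [hk, hs]
    | p i =>
      cases j using k.succAboveCases with
      | x => simp [hk, hs]
      | p j =>
        rw [hs, hs, Set.disjoint_image_iff hinj]
        exact hdisj i j fun h => hij (h ▸ rfl)
  have hbefore (i) : Disjoint (Gs' i) ((MG.mk G.V _ ends').before Gs' i) :=
    Set.disjoint_left.2 fun _ he ⟨j, hj, he'⟩ => Set.disjoint_left.1 (hdisj' i j hj.ne') he he'
  have hafter (i) : Disjoint (Gs' i) ((MG.mk G.V _ ends').after Gs' i) :=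
    Set.disjoint_left.2 fun _ he ⟨j, hj, he'⟩ => Set.disjoint_left.1 (hdisj' i j hj.ne) he he'
  refine ⟨m + 1, Gs', hdisj', ?_, fun i => ?_⟩
  · refine Set.eq_univ_of_forall fun e => Set.mem_iUnion.2 ?_
    obtain _ | e := e
    · exact ⟨k, hk ▸ rfl⟩
    · obtain ⟨i, hi⟩ := Set.mem_iUnion.1 (hcover ▸ Set.mem_univ e : e ∈ ⋃ i, Gs i)
      exact ⟨k.succAbove i, hs i ▸ ⟨e, hi, rfl⟩⟩
  · cases i using k.succAboveCases with
    | x =>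
      have hB := hbefore k
      have hA := hafter k
      rw [hk, Set.disjoint_singleton_left] at hB hA
      refine .inr (.inr ⟨u, v, none, hB, hA, hk, rfl, hu.imp_right fun h => h.trans ?_,
        hv.imp_right fun h => h.trans ?_⟩)
      · refine deg_le_deg_of_image_subset hinj hends ?_ u
        rintro _ ⟨e, ⟨j, hj, he⟩, rfl⟩
        exact ⟨k.succAbove j, (Fin.succAbove_lt_iff_castSucc_lt k j).2 hj, hs j ▸ ⟨e, he, rfl⟩⟩
      · refine deg_le_deg_of_image_subset hinj hends ?_ v
        rintro _ ⟨e, ⟨j, hj, he⟩, rfl⟩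
        exact ⟨k.succAbove j, (Fin.lt_succAbove_iff_le_castSucc k j).2 hj, hs j ▸ ⟨e, he, rfl⟩⟩
    | p i =>
      have hB := hbefore (k.succAbove i)
      have hA := hafter (k.succAbove i)
      have hmono := Fin.strictMono_succAbove k
      rw [hs] at hB hA ⊢
      refine (hchain i).map hinj hends ?_ ?_ hB hA
      · rintro _ ⟨e, ⟨j, hj, he⟩, rfl⟩
        exact ⟨k.succAbove j, hmono hj, hs j ▸ ⟨e, he, rfl⟩⟩
      · rintro _ ⟨e, ⟨j, hj, he⟩, rfl⟩
        exact ⟨k.succAbove j, hmono hj, hs j ▸ ⟨e, he, rfl⟩⟩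

end MG

theorem chain_decomp_add_edge (G : MG) [Finite G.V] [Finite G.E]
    (r : G.V) (hdeg : ∀ v : G.V, v ≠ r → ∃ e : G.E, v ∈ G.ends e)
    (h : G.HasChainDecomp r) (u v : G.V) :
    (G.addEdge s(u, v)).HasChainDecomp r := by
  obtain ⟨m, Gs, hGs⟩ := h
  obtain ⟨k, huk, huk'⟩ := hGs.exists_cut u (hdeg u)
  obtain ⟨l, hvl, hvl'⟩ := hGs.exists_cut v (hdeg v)
  rcases le_total k l with hkl | hlk
  · refine hGs.hasChainDecomp_addEdge k huk (hvl'.imp_right fun h => h.trans ?_)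
    refine MG.deg_mono ?_ v
    rintro e ⟨j, hj, he⟩
    exact ⟨j, hkl.trans hj, he⟩
  · rw [Sym2.eq_swap]
    refine hGs.hasChainDecomp_addEdge l hvl (huk'.imp_right fun h => h.trans ?_)
    refine MG.deg_mono ?_ u
    rintro e ⟨j, hj, he⟩
    exact ⟨j, hlk.trans hj, he⟩
end

section
/- Suppose G is a multigraph with a chain decomposition rooted at a vertex r, and G' is obtained from G by pinching two distinct edges e_1 and e_2, that is: deleting e_1 (with ends x, y) and e_2 (with ends z, w), adding a new vertex v, and adding four new edges joining v to x, y, z, w respectively. Then G' has a chain decomposition rooted at r. -/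
set_option autoImplicit false

namespace MG

section ChainLists

variable {W E : Type} (ends : E → Sym2 W)

open Classical in
/-- The number of times `u` is an end of the edge `e`. -/
noncomputable def edgeDeg (e : E) (u : W) : ℕ :=
  (if u ∈ ends e then 1 else 0) + (if ends e = s(u, u) then 1 else 0)

/-- The degree of `u` with respect to a list of edges, counted with multiplicity;
a loop contributes two. -/
noncomputable def listDeg (es : List E) (u : W) : ℕ :=
  (es.map fun e => edgeDeg ends e u).sum

open Classical in
/-- The degrees contributed by two edges at `v`. -/
noncomputable def bump (v u : W) : ℕ := if u = v then 2 else 0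

/-- `Trail ends a vs es c`: the edges `es` successively link the vertices `vs`,
from `a` to `c`. -/
inductive Trail : W → List W → List E → W → Prop
  | nil (a : W) : Trail a [a] [] a
  | cons {a u c : W} {e : E} {vs : List W} {es : List E} :
      ends e = s(a, u) → Trail u vs es c → Trail a (a :: vs) (e :: es) c

/-- Up chains, open or closed, with the degrees in the two contexts given by `h` and `b`. -/
def UpList (h b : W → ℕ) (es : List E) : Prop :=
  ∃ a vs c, Trail ends a vs es c ∧ vs.tail.Nodup ∧ vs.dropLast.Nodup ∧
    1 ≤ h a ∧ 1 ≤ h c ∧ (a = c → 2 ≤ h a) ∧ ∀ u ∈ vs, 2 ≤ b u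

/-- One-way chains, with the degrees in the two contexts given by `h` and `b`. -/
def OneWayList (h b : W → ℕ) (es : List E) : Prop :=
  ∃ e u w, es = [e] ∧ ends e = s(u, w) ∧ 2 ≤ h u ∧ 2 ≤ b w

/-- Chains, possibly empty, with the degrees in the two contexts given by `h` and `b`. -/
def ChainList (h b : W → ℕ) (es : List E) : Prop :=
  es = [] ∨ UpList ends h b es ∨ UpList ends b h es ∨ OneWayList ends h b es

/-- A sequence of chains, placed after a context with degrees `h` and before a context
with degrees `b`. -/
def ChainSeq (h b : W → ℕ) : List (List E) → Prop
  | [] => True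
  | C :: L => ChainList ends h (b + listDeg ends L.flatten) C ∧
      ChainSeq (h + listDeg ends C) b L

/-- The edges `f` and `g` subdivide the edge `e` at the vertex `v`. -/
def Subdivides (v : W) (e f g : E) : Prop :=
  ∃ x y, ends e = s(x, y) ∧ ends f = s(v, x) ∧ ends g = s(v, y)

/-- The sequence `P` of chains can be replaced by one in which `e` is replaced by `f` and `g`. -/
def Replaceable (e f g : E) (h b : W → ℕ) (P : List (List E)) : Prop :=
  ∃ B R, P.flatten.Perm (e :: R) ∧ B.flatten.Perm (f :: g :: R) ∧ ChainSeq ends h b B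

variable {ends}

/-! ### Degrees -/

@[simp] lemma listDeg_nil (u : W) : listDeg ends [] u = 0 := rfl

@[simp] lemma listDeg_cons (e : E) (es : List E) (u : W) :
    listDeg ends (e :: es) u = edgeDeg ends e u + listDeg ends es u := by
  simp [listDeg]

@[simp] lemma listDeg_append (es fs : List E) (u : W) :
    listDeg ends (es ++ fs) u = listDeg ends es u + listDeg ends fs u := by
  simp [listDeg]

lemma listDeg_perm {es fs : List E} (p : es.Perm fs) (u : W) :
    listDeg ends es u = listDeg ends fs u :=
  (p.map _).sum_eq

open Classical in
lemma edgeDeg_eq {e : E} {a c : W} (he : ends e = s(a, c)) (u : W) :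
    edgeDeg ends e u = (if u = a then 1 else 0) + (if u = c then 1 else 0) := by
  simp only [edgeDeg, he, Sym2.mem_iff, Sym2.eq_iff]
  by_cases h1 : u = a <;> by_cases h2 : u = c <;> simp [h1, h2, eq_comm] <;> grind

lemma Subdivides.listDeg_eq {v : W} {e f g : E} (s : Subdivides ends v e f g)
    (es : List E) (u : W) :
    listDeg ends (f :: g :: es) u = listDeg ends (e :: es) u + bump v u := by
  obtain ⟨x, y, he, hf, hg⟩ := s
  simp only [listDeg_cons, edgeDeg_eq he, edgeDeg_eq hf, edgeDeg_eq hg, bump]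
  split_ifs <;> omega

lemma Subdivides.orient {v : W} {e f g : E} (s : Subdivides ends v e f g) {x y : W}
    (he : ends e = s(x, y)) :
    ∃ p q, ends p = s(v, x) ∧ ends q = s(v, y) ∧ [p, q].Perm [f, g] := by
  obtain ⟨x', y', he', hf, hg⟩ := s
  rw [he, Sym2.eq_iff] at he'
  rcases he' with ⟨rfl, rfl⟩ | ⟨rfl, rfl⟩
  · exact ⟨f, g, hf, hg, .refl _⟩
  · exact ⟨g, f, hg, hf, .swap _ _ _⟩

/-! ### Trails -/

lemma Trail.left_mem {a c : W} {vs : List W} {es : List E} (t : Trail ends a vs es c) :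
    a ∈ vs := by
  cases t <;> simp

lemma Trail.right_mem {a c : W} {vs : List W} {es : List E} (t : Trail ends a vs es c) :
    c ∈ vs := by
  induction t with
  | nil => simp
  | cons _ _ ih => simp [ih]

lemma Trail.ne_nil {a c : W} {vs : List W} {es : List E} (t : Trail ends a vs es c) :
    vs ≠ [] := List.ne_nil_of_mem t.left_mem

lemma Trail.head? {a c : W} {vs : List W} {es : List E} (t : Trail ends a vs es c) :
    vs.head? = some a := by
  cases t <;> simp

lemma Trail.getLast? {a c : W} {vs : List W} {es : List E} (t : Trail ends a vs es c) :
    vs.getLast? = some c := by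
  induction t with
  | nil => simp
  | cons _ t ih => rw [List.getLast?_cons, ih]; simp

lemma Trail.mem_of_mem_ends {a c : W} {vs : List W} {es : List E} (t : Trail ends a vs es c)
    {e : E} (he : e ∈ es) {u : W} (hu : u ∈ ends e) : u ∈ vs := by
  induction t with
  | nil => simp at he
  | cons h t ih =>
    rcases List.mem_cons.1 he with rfl | he
    · rw [h, Sym2.mem_iff] at hu
      rcases hu with rfl | rfl
      · simp
      · simp [t.left_mem]
    · simp [ih he]

lemma Trail.exists_mem_ends {a c : W} {vs : List W} {es : List E} (t : Trail ends a vs es c)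
    (hes : es ≠ []) {u : W} (hu : u ∈ vs) : ∃ e ∈ es, u ∈ ends e := by
  induction t with
  | nil => simp at hes
  | @cons a w c e vs es h t ih =>
    rcases List.mem_cons.1 hu with rfl | hu
    · exact ⟨e, by simp, by simp [h]⟩
    · cases t with
      | nil =>
        obtain rfl : u = w := by simpa using hu
        exact ⟨e, by simp, by simp [h]⟩
      | cons h' t' =>
        obtain ⟨e', he', hu'⟩ := ih (by simp) hu
        exact ⟨e', by simp [he'], hu'⟩

lemma listDeg_eq_zero {es : List E} {u : W} (hu : ∀ e ∈ es, u ∉ ends e) :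
    listDeg ends es u = 0 := by
  refine List.sum_eq_zero fun n hn => ?_
  obtain ⟨e, he, rfl⟩ := List.mem_map.1 hn
  have : ends e ≠ s(u, u) := fun h => hu e he (by simp [h])
  simp [edgeDeg, hu e he, this]

lemma Trail.listDeg_eq_zero {a c : W} {vs : List W} {es : List E} (t : Trail ends a vs es c)
    {u : W} (hu : u ∉ vs) : listDeg ends es u = 0 :=
  MG.listDeg_eq_zero fun _ he h => hu (t.mem_of_mem_ends he h)

lemma Trail.join {a x y c : W} {vs₁ vs₂ : List W} {es₁ es₂ : List E} {e : E}
    (t₁ : Trail ends a vs₁ es₁ x) (he : ends e = s(x, y)) (t₂ : Trail ends y vs₂ es₂ c) :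
    Trail ends a (vs₁ ++ vs₂) (es₁ ++ e :: es₂) c := by
  induction t₁ with
  | nil => exact .cons he t₂
  | cons h _ ih => exact .cons h (ih he)

lemma Trail.split {es₁ : List E} : ∀ {a c : W} {vs : List W} {es₂ : List E} {e : E},
    Trail ends a vs (es₁ ++ e :: es₂) c →
    ∃ vs₁ vs₂ x y, vs = vs₁ ++ vs₂ ∧ Trail ends a vs₁ es₁ x ∧ ends e = s(x, y) ∧
      Trail ends y vs₂ es₂ c := by
  induction es₁ with
  | nil =>
    intro a c vs es₂ e t
    cases t with
    | cons h t => exact ⟨[a], _, a, _, rfl, .nil a, h, t⟩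
  | cons e' es₁ ih =>
    intro a c vs es₂ e t
    cases t with
    | cons h t =>
      obtain ⟨vs₁, vs₂, x, y, rfl, t₁, he, t₂⟩ := ih t
      exact ⟨_ :: vs₁, vs₂, x, y, rfl, .cons h t₁, he, t₂⟩

lemma Trail.reverse {a c : W} {vs : List W} {es : List E} (t : Trail ends a vs es c) :
    Trail ends c vs.reverse es.reverse a := by
  induction t with
  | nil => exact .nil _
  | cons h _ ih =>
    rw [List.reverse_cons, List.reverse_cons]
    exact ih.join (by rw [h, Sym2.eq_swap]) (.nil _)

lemma Trail.nodup {a c : W} {vs : List W} {es : List E} (t : Trail ends a vs es c)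
    (h₁ : vs.tail.Nodup) (h₂ : vs.dropLast.Nodup) (hac : a ≠ c) : vs.Nodup := by
  cases t with
  | nil => simp
  | @cons _ u _ e vs es h t =>
    refine List.nodup_cons.2 ⟨fun ha => ?_, h₁⟩
    obtain ⟨l, rfl⟩ : ∃ l, vs = l ++ [c] :=
      ⟨vs.dropLast, (List.dropLast_append_getLast? c t.getLast?).symm⟩
    rw [← List.cons_append, List.dropLast_concat, List.nodup_cons] at h₂
    simp [hac, h₂.1] at ha

lemma Trail.left_ne_right {a c : W} {vs : List W} {es : List E} (t : Trail ends a vs es c)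
    (hv : vs.Nodup) (hes : es ≠ []) : a ≠ c := by
  cases t with
  | nil => simp at hes
  | cons h t =>
    rintro rfl
    exact (List.nodup_cons.1 hv).1 t.right_mem

/-! ### Chains -/

lemma UpList.reverse {h b : W → ℕ} {es : List E} (H : UpList ends h b es) :
    UpList ends h b es.reverse := by
  obtain ⟨a, vs, c, t, h₁, h₂, ha, hc, hac, hb⟩ := H
  exact ⟨c, vs.reverse, a, t.reverse, by simpa, by simpa, hc, ha,
    fun e => e ▸ hac e.symm, by simpa⟩

lemma UpList.mono {h b h' b' : W → ℕ} {es : List E} (H : UpList ends h b es)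
    (hh : ∀ u, h u ≤ h' u) (hb : ∀ u, b u ≤ b' u) : UpList ends h' b' es := by
  obtain ⟨a, vs, c, t, h₁, h₂, ha, hc, hac, hbb⟩ := H
  exact ⟨a, vs, c, t, h₁, h₂, ha.trans (hh a), hc.trans (hh c),
    fun e => (hac e).trans (hh a), fun u hu => (hbb u hu).trans (hb u)⟩

lemma ChainList.mono {h b h' b' : W → ℕ} {es : List E} (H : ChainList ends h b es)
    (hh : ∀ u, h u ≤ h' u) (hb : ∀ u, b u ≤ b' u) : ChainList ends h' b' es := by
  rcases H with H | H | H | ⟨e, u, w, rfl, he, hu, hw⟩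
  · exact .inl H
  · exact .inr (.inl (H.mono hh hb))
  · exact .inr (.inr (.inl (H.mono hb hh)))
  · exact .inr (.inr (.inr ⟨e, u, w, rfl, he, hu.trans (hh u), hw.trans (hb w)⟩))

lemma ChainList.symm {h b : W → ℕ} {es : List E} (H : ChainList ends h b es) :
    ChainList ends b h es := by
  rcases H with H | H | H | ⟨e, u, w, rfl, he, hu, hw⟩
  · exact .inl H
  · exact .inr (.inr (.inl H))
  · exact .inr (.inl H)
  · exact .inr (.inr (.inr ⟨e, w, u, rfl, by rw [he, Sym2.eq_swap], hw, hu⟩))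

lemma Trail.chainList {a c : W} {vs : List W} {es : List E} (t : Trail ends a vs es c)
    {h b : W → ℕ} (hv : vs.Nodup) (ha : 1 ≤ h a) (hc : 1 ≤ h c) (hb : ∀ u ∈ vs, 2 ≤ b u) :
    ChainList ends h b es := by
  rcases eq_or_ne es [] with rfl | hes
  · exact .inl rfl
  · exact .inr (.inl ⟨a, vs, c, t, hv.sublist (List.tail_sublist _),
      hv.sublist (List.dropLast_sublist _), ha, hc,
      fun e => absurd e (t.left_ne_right hv hes), hb⟩)

lemma Trail.chainList_down {a c : W} {vs : List W} {es : List E} (t : Trail ends a vs es c)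
    {h b : W → ℕ} (hv : vs.Nodup) (ha : 1 ≤ b a) (hc : 1 ≤ b c) (hh : ∀ u ∈ vs, 2 ≤ h u) :
    ChainList ends h b es :=
  (t.chainList hv ha hc hh).symm

lemma chainList_oneWay {e : E} {u w : W} {h b : W → ℕ} (he : ends e = s(u, w))
    (hu : 2 ≤ h u) (hw : 2 ≤ b w) : ChainList ends h b [e] :=
  .inr (.inr (.inr ⟨e, u, w, rfl, he, hu, hw⟩))

lemma chainList_oneWay' {e : E} {u w : W} {h b : W → ℕ} (he : ends e = s(u, w))
    (hu : 2 ≤ b u) (hw : 2 ≤ h w) : ChainList ends h b [e] :=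
  chainList_oneWay (by rw [he, Sym2.eq_swap]) hw hu

lemma nodup_left_of_append {vs₁ vs₂ : List W} (h₂ : vs₂ ≠ [])
    (h : (vs₁ ++ vs₂).dropLast.Nodup) : vs₁.Nodup := by
  rw [List.dropLast_append_of_ne_nil h₂] at h
  exact h.of_append_left

lemma nodup_right_of_append {vs₁ vs₂ : List W} (h₁ : vs₁ ≠ [])
    (h : (vs₁ ++ vs₂).tail.Nodup) : vs₂.Nodup := by
  rw [List.tail_append_of_ne_nil h₁] at h
  exact h.of_append_right

lemma nodup_insert {v : W} {vs₁ m vs₂ : List W} (h : (vs₁ ++ (m ++ vs₂)).Nodup)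
    (hv₁ : v ∉ vs₁) (hv₂ : v ∉ vs₂) : (vs₁ ++ v :: vs₂).Nodup := by
  grind

lemma tail_nodup_insert {v : W} {vs₁ m vs₂ : List W} (h₁ : vs₁ ≠ [])
    (h : (vs₁ ++ (m ++ vs₂)).tail.Nodup)
    (hv₁ : v ∉ vs₁) (hv₂ : v ∉ vs₂) : (vs₁ ++ v :: vs₂).tail.Nodup := by
  rw [List.tail_append_of_ne_nil h₁] at *
  exact nodup_insert h (fun H => hv₁ (List.mem_of_mem_tail H)) hv₂

lemma dropLast_nodup_insert {v : W} {vs₁ m vs₂ : List W} (h₂ : vs₂ ≠ [])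
    (h : (vs₁ ++ (m ++ vs₂)).dropLast.Nodup)
    (hv₁ : v ∉ vs₁) (hv₂ : v ∉ vs₂) : (vs₁ ++ v :: vs₂).dropLast.Nodup := by
  rw [List.dropLast_append_of_ne_nil (by simp [h₂]), List.dropLast_append_of_ne_nil h₂] at h
  rw [List.dropLast_append_of_ne_nil (by simp), List.dropLast_cons_of_ne_nil h₂]
  exact nodup_insert h hv₁ (fun H => hv₂ (List.mem_of_mem_dropLast H))

/-! ### Sequences of chains -/

lemma ChainSeq.mono {L : List (List E)} : ∀ {h b h' b' : W → ℕ}, ChainSeq ends h b L →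
    (∀ u, h u ≤ h' u) → (∀ u, b u ≤ b' u) → ChainSeq ends h' b' L := by
  induction L with
  | nil => intros; trivial
  | cons C L ih =>
    intro h b h' b' H hh hb
    exact ⟨H.1.mono hh fun u => Nat.add_le_add_right (hb u) _,
      ih H.2 (fun u => Nat.add_le_add_right (hh u) _) hb⟩

lemma ChainSeq.congr {L : List (List E)} {h b h' b' : W → ℕ} (H : ChainSeq ends h b L)
    (hh : ∀ u, h u = h' u) (hb : ∀ u, b u = b' u) : ChainSeq ends h' b' L :=
  H.mono (fun u => (hh u).le) (fun u => (hb u).le)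

lemma chainSeq_append {L₁ L₂ : List (List E)} : ∀ {h b : W → ℕ},
    ChainSeq ends h b (L₁ ++ L₂) ↔ ChainSeq ends h (b + listDeg ends L₂.flatten) L₁ ∧
      ChainSeq ends (h + listDeg ends L₁.flatten) b L₂ := by
  induction L₁ with
  | nil =>
    intro h b
    have : h + listDeg ends ([] : List (List E)).flatten = h := by ext u; simp
    rw [this]
    simp [ChainSeq]
  | cons C L₁ ih =>
    intro h b
    have e₁ : b + listDeg ends (L₁ ++ L₂).flatten
        = b + listDeg ends L₂.flatten + listDeg ends L₁.flatten := by
      ext u; simp; omega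
    have e₂ : h + listDeg ends (C :: L₁).flatten
        = h + listDeg ends C + listDeg ends L₁.flatten := by
      ext u; simp; omega
    rw [List.cons_append, ChainSeq, ChainSeq, ih, e₁, e₂, and_assoc]

lemma chainSeq_singleton {C : List E} {h b : W → ℕ} :
    ChainSeq ends h b [C] ↔ ChainList ends h b C := by
  have : b + listDeg ends ([] : List (List E)).flatten = b := by ext u; simp
  simp only [ChainSeq, this, and_true]

lemma ChainSeq.reverse {L : List (List E)} : ∀ {h b : W → ℕ}, ChainSeq ends h b L →
    ChainSeq ends b h L.reverse := by
  induction L with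
  | nil => intros; trivial
  | cons C L ih =>
    intro h b H
    rw [List.reverse_cons, chainSeq_append, chainSeq_singleton]
    refine ⟨(ih H.2).congr (fun _ => rfl) (by simp), H.1.symm.mono (fun u => ?_) fun _ => le_rfl⟩
    simp [listDeg_perm L.reverse_perm.flatten]

lemma chainSeq_iff {L : List (List E)} {h b : W → ℕ} :
    ChainSeq ends h b L ↔ ∀ A C B, L = A ++ C :: B →
      ChainList ends (h + listDeg ends A.flatten) (b + listDeg ends B.flatten) C := by
  induction L generalizing h with
  | nil => simp [ChainSeq]
  | cons D L ih =>
    constructor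
    · rintro H A C B e
      rw [e, chainSeq_append] at H
      exact H.2.1
    · intro H
      refine ⟨(H [] D L rfl).mono (by simp) (fun _ => le_rfl), ih.2 fun A C B e => ?_⟩
      refine (H (D :: A) C B (by simp [e])).mono (fun u => ?_) fun _ => le_rfl
      simp; omega

lemma Replaceable.mono {e f g : E} {h b h' b' : W → ℕ} {P : List (List E)}
    (H : Replaceable ends e f g h b P) (hh : ∀ u, h u ≤ h' u) (hb : ∀ u, b u ≤ b' u) :
    Replaceable ends e f g h' b' P := by
  obtain ⟨B, R, h₁, h₂, h₃⟩ := H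
  exact ⟨B, R, h₁, h₂, h₃.mono hh hb⟩

lemma flatten_reverse_perm (L : List (List E)) : L.reverse.flatten.Perm L.flatten :=
  L.reverse_perm.flatten

/-! ### Local replacements -/

lemma UpList.exists_split {h b : W → ℕ} {es₁ es₂ : List E} {e : E}
    (H : UpList ends h b (es₁ ++ e :: es₂)) :
    ∃ a vs₁ x y vs₂ c, Trail ends a vs₁ es₁ x ∧ ends e = s(x, y) ∧ Trail ends y vs₂ es₂ c ∧
      vs₁.Nodup ∧ vs₂.Nodup ∧ 1 ≤ h a ∧ 1 ≤ h c ∧ (a = c → 2 ≤ h a) ∧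
      (∀ u ∈ vs₁, 2 ≤ b u) ∧ (∀ u ∈ vs₂, 2 ≤ b u) := by
  obtain ⟨a, vs, c, t, h₁, h₂, ha, hc, hac, hb⟩ := H
  obtain ⟨vs₁, vs₂, x, y, rfl, t₁, he, t₂⟩ := t.split
  exact ⟨a, vs₁, x, y, vs₂, c, t₁, he, t₂, nodup_left_of_append t₂.ne_nil h₂,
    nodup_right_of_append t₁.ne_nil h₁, ha, hc, hac,
    fun u hu => hb u (by simp [hu]), fun u hu => hb u (by simp [hu])⟩

lemma Trail.not_mem {a c v : W} {vs : List W} {es : List E} (t : Trail ends a vs es c)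
    (hv : ∀ e ∈ es, v ∉ ends e) (ha : a ≠ v) : v ∉ vs := by
  intro H
  rcases eq_or_ne es [] with rfl | hes
  · cases t
    simp [ha.symm] at H
  · obtain ⟨e, he, h⟩ := t.exists_mem_ends hes H
    exact hv e he h

/-- An edge of a chain can be subdivided at a vertex with two edges in the later chains, unless
the chain is a one-way chain whose head is not in an earlier chain. -/
lemma ChainList.replaceable {h b b' : W → ℕ} {C : List E} {v : W} {e f g : E}
    (H : ChainList ends h b C) (he : e ∈ C) (s : Subdivides ends v e f g)
    (hv : ∀ e ∈ C, v ∉ ends e) (hb : ∀ u, b u ≤ b' u) (hbv : 2 ≤ b' v) :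
    Replaceable ends e f g h b' [C] ∨
      ∃ x y, C = [e] ∧ ends e = s(x, y) ∧ 2 ≤ h x ∧ 2 ≤ b y ∧ h y = 0 := by
  rcases H with rfl | H | H | ⟨e', x, y, rfl, hxy, hx, hy⟩
  · simp at he
  · left
    obtain ⟨A, B, rfl⟩ := List.append_of_mem he
    obtain ⟨a, vs, c, t, h₁, h₂, ha, hc, hac, hbb⟩ := H
    obtain ⟨vs₁, vs₂, x, y, rfl, t₁, hxy, t₂⟩ := t.split
    obtain ⟨p, q, hp, hq, hpq⟩ := s.orient hxy
    have hve := hv e he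
    simp only [hxy, Sym2.mem_iff, not_or] at hve
    have hv₁ : v ∉ vs₁ := fun H => (t₁.reverse.not_mem (v := v)
      (fun e he => hv e (by simp at he; simp [he])) (Ne.symm hve.1)) (by simpa)
    have hv₂ : v ∉ vs₂ := t₂.not_mem (fun e he => hv e (by simp [he])) (Ne.symm hve.2)
    refine ⟨[A ++ p :: q :: B], A ++ B, by simp, ?_, chainSeq_singleton.2 (.inr (.inl
      ⟨a, vs₁ ++ v :: vs₂, c, t₁.join (by rw [hp, Sym2.eq_swap]) (.cons hq t₂),
        tail_nodup_insert (m := []) t₁.ne_nil h₁ hv₁ hv₂,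
        dropLast_nodup_insert (m := []) t₂.ne_nil h₂ hv₁ hv₂, ha, hc, hac, ?_⟩))⟩
    · classical
      have := hpq.count_eq
      simp only [List.perm_iff_count, List.count_append, List.count_cons, List.flatten_cons,
        List.flatten_nil, List.count_nil] at this ⊢
      intro a
      have := this a
      omega
    · intro u hu
      rcases eq_or_ne u v with rfl | huv
      · exact hbv
      · exact (hbb u (by simpa [huv] using hu)).trans (hb u)
  · left
    obtain ⟨A, B, rfl⟩ := List.append_of_mem he
    obtain ⟨a, vs₁, x, y, vs₂, c, t₁, hxy, t₂, n₁, n₂, ha, hc, -, hh₁, hh₂⟩ := H.exists_split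
    obtain ⟨p, q, hp, hq, hpq⟩ := s.orient hxy
    have hp' := edgeDeg_eq hp
    have hq' := edgeDeg_eq hq
    refine ⟨[A, B, [p], [q]], A ++ B, by simp, ?_, ?_, ?_, ?_, ?_, trivial⟩
    · classical
      have := hpq.count_eq
      simp only [List.perm_iff_count, List.count_append, List.count_cons, List.flatten_cons,
        List.flatten_nil, List.count_nil] at this ⊢
      intro a
      have := this a
      omega
    · refine t₁.chainList_down n₁ ?_ ?_ hh₁
      · have := hb a; simp; omega
      · simp [hp']; omega
    · refine t₂.chainList_down n₂ ?_ ?_ ?_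
      · simp [hq']; omega
      · have := hb c; simp; omega
      · intro u hu; have := hh₂ u hu; simp; omega
    · refine chainList_oneWay' hp ?_ ?_
      · simp; omega
      · have := hh₁ x t₁.right_mem; simp; omega
    · refine chainList_oneWay' hq ?_ ?_
      · simp; omega
      · have := hh₂ y t₂.left_mem; simp; omega
  · obtain rfl : e = e' := by simpa using he
    rcases Nat.eq_zero_or_pos (h y) with h0 | h0
    · exact .inr ⟨x, y, rfl, hxy, hx, hy, h0⟩
    left
    obtain ⟨p, q, hp, hq, hpq⟩ := s.orient hxy
    have hp' := edgeDeg_eq hp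
    have hve := hv e he
    simp only [hxy, Sym2.mem_iff, not_or] at hve
    refine ⟨[[p], [q]], [], by simp, by simpa using hpq, ?_, ?_, trivial⟩
    · refine chainList_oneWay' hp ?_ ?_
      · simp; omega
      · simpa using hx
    · refine (Trail.cons hq (.nil y)).chainList (by simp [hve.2]) ?_ ?_ ?_
      · simp [hp']; omega
      · simp; omega
      · have := hb y
        simp; omega

lemma le_of_le_add_listDeg {h : W → ℕ} {e : E} {x y u : W} {k : ℕ} (he : ends e = s(x, y))
    (hx : 2 ≤ h x) (hk : k ≤ 2) (hu : u ≠ y) (H : k ≤ h u + listDeg ends [e] u) : k ≤ h u := by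
  simp only [listDeg_cons, listDeg_nil, edgeDeg_eq he, if_neg hu] at H
  split_ifs at H with hux
  · rw [hux]; omega
  · omega

/-- A one-way chain whose head is not in an earlier chain can be exchanged with the next chain,
unless the latter is an up chain that ends at this head. -/
lemma ChainList.exchange {h b : W → ℕ} {D : List E} {e : E} {x y : W}
    (H : ChainList ends (h + listDeg ends [e]) b D) (he : ends e = s(x, y)) (hx : 2 ≤ h x)
    (hy : h y = 0) (hby : 2 ≤ b y + listDeg ends D y) :
    ChainSeq ends h b [D, [e]] ∨
      ∃ vs c es, es.Perm D ∧ Trail ends y vs es c ∧ vs.Nodup ∧ c ≠ y ∧ 1 ≤ h c ∧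
        ∀ u ∈ vs, 2 ≤ b u := by
  have hxy : x ≠ y := by rintro rfl; omega
  have he' := edgeDeg_eq he
  have hy1 : (h + listDeg ends [e]) y = 1 := by simp [he', hy, hxy.symm]
  have key : ∀ {u k}, k ≤ 2 → u ≠ y → k ≤ (h + listDeg ends [e]) u → k ≤ h u :=
    fun hk hu H => le_of_le_add_listDeg he hx hk hu H
  have fin : ChainList ends h b D → 2 ≤ b y → ChainSeq ends h b [D, [e]] := by
    intro h₁ h₂
    refine ⟨h₁.mono (fun _ => le_rfl) (fun u => by simp), chainList_oneWay he ?_ ?_, trivial⟩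
    · simp; omega
    · simp; omega
  rcases H with rfl | H | H | ⟨e', u, w, rfl, huw, hu, hw⟩
  · exact .inl (fin (.inl rfl) (by simpa using hby))
  · obtain ⟨a, vs, c, t, h₁, h₂, ha, hc, hac, hbb⟩ := H
    rcases eq_or_ne a y with rfl | hay
    · have hca : c ≠ a := by
        rintro rfl; have := hac rfl; omega
      exact .inr ⟨vs, c, D, .refl _, t, t.nodup h₁ h₂ hca.symm, hca, key (by omega) hca hc, hbb⟩
    rcases eq_or_ne c y with rfl | hcy
    · exact .inr ⟨vs.reverse, a, D.reverse, D.reverse_perm, t.reverse,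
        by simpa using t.nodup h₁ h₂ hay, hay, key (by omega) hay ha, by simpa using hbb⟩
    · refine .inl (fin (.inr (.inl ⟨a, vs, c, t, h₁, h₂, key (by omega) hay ha,
        key (by omega) hcy hc, fun E => key le_rfl hay (hac E), hbb⟩)) ?_)
      by_cases hyv : y ∈ vs
      · exact hbb y hyv
      · rwa [t.listDeg_eq_zero hyv] at hby
  · obtain ⟨a, vs, c, t, h₁, h₂, ha, hc, hac, hhh⟩ := H
    have hyv : y ∉ vs := fun H => by have := hhh y H; omega
    refine .inl (fin (.inr (.inr (.inl ⟨a, vs, c, t, h₁, h₂, ha, hc, hac,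
      fun u hu => key le_rfl (fun E => hyv (E ▸ hu)) (hhh u hu)⟩))) ?_)
    rwa [t.listDeg_eq_zero hyv] at hby
  · have huy : u ≠ y := by rintro rfl; omega
    refine .inl (fin (chainList_oneWay huw (key le_rfl huy hu) hw) ?_)
    rcases eq_or_ne w y with rfl | hwy
    · exact hw
    · simpa [edgeDeg_eq huw, huy.symm, hwy.symm] using hby

/-- Two edges of an up chain can be pinched. -/
lemma UpList.pinch_ordered {h b : W → ℕ} {es₁ es₂ es₃ : List E} {v : W}
    {e₁ f₁ g₁ e₂ f₂ g₂ : E}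
    (H : UpList ends h b (es₁ ++ e₁ :: (es₂ ++ e₂ :: es₃)))
    (s₁ : Subdivides ends v e₁ f₁ g₁) (s₂ : Subdivides ends v e₂ f₂ g₂)
    (hv : ∀ e ∈ es₁ ++ e₁ :: (es₂ ++ e₂ :: es₃), v ∉ ends e) :
    ∃ B, B.flatten.Perm (f₁ :: g₁ :: f₂ :: g₂ :: (es₁ ++ (es₂ ++ es₃))) ∧
      ChainSeq ends h b B := by
  obtain ⟨a, vs, c, t, h₁, h₂, ha, hc, hac, hbb⟩ := H
  obtain ⟨vs₁, vs', x, y, rfl, t₁, hxy, t'⟩ := t.split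
  obtain ⟨vs₂, vs₃, z, w, rfl, t₂, hzw, t₃⟩ := t'.split
  obtain ⟨p, q, hp, hq, hpq⟩ := s₁.orient hxy
  obtain ⟨p', q', hp', hq', hpq'⟩ := s₂.orient hzw
  have hve₁ := hv e₁ (by simp)
  have hve₂ := hv e₂ (by simp)
  simp only [hxy, hzw, Sym2.mem_iff, not_or] at hve₁ hve₂
  have hv₁ : v ∉ vs₁ := fun H => (t₁.reverse.not_mem (v := v)
    (fun e he => hv e (by simp at he; simp [he])) (Ne.symm hve₁.1)) (by simpa)
  have hv₃ : v ∉ vs₃ := t₃.not_mem (fun e he => hv e (by simp [he])) (Ne.symm hve₂.2)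
  have dp := edgeDeg_eq hp
  have dq := edgeDeg_eq hq
  have dp' := edgeDeg_eq hp'
  have dq' := edgeDeg_eq hq'
  have n₂ : vs₂.Nodup := nodup_left_of_append t₃.ne_nil
    (by rw [List.dropLast_append_of_ne_nil (by simp [t₂.ne_nil])] at h₂
        exact h₂.of_append_right)
  refine ⟨[es₁ ++ p :: q' :: es₃, [q], [p'], es₂], ?_, ?_, ?_, ?_, ?_, trivial⟩
  · classical
    have i₁ := hpq.count_eq
    have i₂ := hpq'.count_eq
    simp only [List.perm_iff_count, List.count_append, List.count_cons, List.flatten_cons,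
      List.flatten_nil, List.count_nil] at i₁ i₂ ⊢
    intro a
    have := i₁ a
    have := i₂ a
    omega
  · refine .inr (.inl ⟨a, vs₁ ++ v :: vs₃, c,
      t₁.join (by rw [hp, Sym2.eq_swap]) (.cons hq' t₃),
      tail_nodup_insert t₁.ne_nil h₁ hv₁ hv₃,
      dropLast_nodup_insert t₃.ne_nil h₂ hv₁ hv₃, ha, hc, hac, ?_⟩)
    intro u hu
    rcases eq_or_ne u v with rfl | huv
    · simp [dq, dp']; omega
    · have := hbb u (by simp [huv] at hu; rcases hu with hu | hu <;> simp [hu])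
      simp; omega
  · refine chainList_oneWay hq ?_ ?_
    · simp [dp, dq']; omega
    · have := hbb y (by simp [t₂.left_mem])
      simp; omega
  · refine chainList_oneWay hp' ?_ ?_
    · simp [dp, dq']; omega
    · have := hbb z (by simp [t₂.right_mem])
      simp; omega
  · refine t₂.chainList n₂ ?_ ?_ fun u hu => ?_
    · simp [dq]; omega
    · simp [dp']; omega
    · have := hbb u (by simp [hu])
      simp; omega

/-- A one-way chain whose head is not in an earlier chain can be pinched with an edge of the
next chain. -/
lemma ChainList.pinch_adjacent {h b : W → ℕ} {C : List E} {v x y : W}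
    {e₁ f₁ g₁ e₂ f₂ g₂ : E}
    (H : ChainList ends (h + listDeg ends [e₁]) b C) (hC : e₂ ∈ C)
    (he : ends e₁ = s(x, y)) (hx : 2 ≤ h x) (hy : h y = 0) (hby : 2 ≤ b y + listDeg ends C y)
    (s₁ : Subdivides ends v e₁ f₁ g₁) (s₂ : Subdivides ends v e₂ f₂ g₂)
    (hv : ∀ e ∈ C, v ∉ ends e) :
    ∃ B R, C.Perm (e₂ :: R) ∧ B.flatten.Perm (f₁ :: g₁ :: f₂ :: g₂ :: R) ∧
      ChainSeq ends h b B := by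
  have hxy : x ≠ y := by rintro rfl; omega
  have he' := edgeDeg_eq he
  have hy1 : (h + listDeg ends [e₁]) y = 1 := by simp [he', hy, hxy.symm]
  have key : ∀ {u k}, k ≤ 2 → u ≠ y → k ≤ (h + listDeg ends [e₁]) u → k ≤ h u :=
    fun hk hu H => le_of_le_add_listDeg he hx hk hu H
  obtain ⟨p, q, hp, hq, hpq⟩ := s₁.orient he
  have dp := edgeDeg_eq hp
  have dq := edgeDeg_eq hq
  have i₁ := fun [DecidableEq E] => hpq.count_eq
  rcases H with rfl | H | H | ⟨e', z, w, rfl, hzw, hz, hw⟩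
  · simp at hC
  · obtain ⟨es, hes, a, vs, c, t, h₁, h₂, ha, hc, hbb, hcy⟩ : ∃ es : List E, es.Perm C ∧
        ∃ a vs c, Trail ends a vs es c ∧ vs.tail.Nodup ∧ vs.dropLast.Nodup ∧
        1 ≤ (h + listDeg ends [e₁]) a ∧ 1 ≤ (h + listDeg ends [e₁]) c ∧ (∀ u ∈ vs, 2 ≤ b u) ∧
        c ≠ y := by
      obtain ⟨a, vs, c, t, h₁, h₂, ha, hc, hac, hbb⟩ := H
      rcases eq_or_ne c y with rfl | hcy
      · refine ⟨C.reverse, C.reverse_perm, c, vs.reverse, a, t.reverse, by simpa, by simpa,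
          hc, ha, by simpa, ?_⟩
        rintro rfl
        have := hac rfl
        omega
      · exact ⟨C, .refl _, a, vs, c, t, h₁, h₂, ha, hc, hbb, hcy⟩
    replace hC := hes.mem_iff.2 hC
    replace hv := fun e he => hv e (hes.mem_iff.1 he)
    rw [← listDeg_perm hes] at hby
    obtain ⟨A, B, rfl⟩ := List.append_of_mem hC
    have hby' : 2 ≤ b y := by
      by_cases hyv : y ∈ vs
      · exact hbb y hyv
      · rwa [t.listDeg_eq_zero hyv] at hby
    obtain ⟨vs₁, vs₂, z, w, rfl, t₁, hzw, t₂⟩ := t.split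
    have n₁ := nodup_left_of_append t₂.ne_nil h₂
    have n₂ := nodup_right_of_append t₁.ne_nil h₁
    obtain ⟨p', q', hp', hq', hpq'⟩ := s₂.orient hzw
    have dp' := edgeDeg_eq hp'
    have dq' := edgeDeg_eq hq'
    have hve := hv e₂ hC
    simp only [hzw, Sym2.mem_iff, not_or] at hve
    have hv₂ : v ∉ vs₂ := t₂.not_mem (fun e he => hv e (by simp [he])) (Ne.symm hve.2)
    have hz := hbb z (by simp [t₁.right_mem])
    refine ⟨[[p], q' :: B, [p'], [q], A], A ++ B, hes.symm.trans (by simp),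
      ?_, ?_, ?_, ?_, ?_, ?_, trivial⟩
    · classical
      have i₂ := hpq'.count_eq
      simp only [List.perm_iff_count, List.count_append, List.count_cons, List.flatten_cons,
        List.flatten_nil, List.count_nil] at i₁ i₂ ⊢
      intro a
      have := i₁ a
      have := i₂ a
      omega
    · refine chainList_oneWay' hp ?_ hx
      simp [dp', dq', dq]; omega
    · refine (Trail.cons hq' t₂).chainList (List.nodup_cons.2 ⟨hv₂, n₂⟩) ?_ ?_
        fun u hu => ?_
      · simp [dp]; omega
      · have := key (by omega) hcy hc
        simp; omega
      · rcases List.mem_cons.1 hu with rfl | hu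
        · simp [dq, dp']; omega
        · have := hbb u (by simp [hu])
          simp; omega
    · refine chainList_oneWay hp' ?_ ?_
      · simp [dq', dp]; omega
      · simp; omega
    · refine chainList_oneWay hq ?_ ?_
      · simp [dp, dp', dq']; omega
      · simp; omega
    · refine t₁.chainList n₁ ?_ ?_ fun u hu => ?_
      · rcases eq_or_ne a y with rfl | hay
        · simp [dq]; omega
        · have := key (by omega) hay ha
          simp; omega
      · simp [dp']; omega
      · have := hbb u (by simp [hu])
        simp; omega
  · obtain ⟨A, B, rfl⟩ := List.append_of_mem hC
    obtain ⟨a, vs₁, z, w, vs₂, c, t₁, hzw, t₂, n₁, n₂, ha, hc, -, hh₁, hh₂⟩ := H.exists_split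
    obtain ⟨p', q', hp', hq', hpq'⟩ := s₂.orient hzw
    have dp' := edgeDeg_eq hp'
    have dq' := edgeDeg_eq hq'
    have hy₁ : y ∉ vs₁ := fun H => by have := hh₁ y H; omega
    have hy₂ : y ∉ vs₂ := fun H => by have := hh₂ y H; omega
    have hve := hv e₂ hC
    simp only [hzw, Sym2.mem_iff, not_or] at hve
    have hv₂ : v ∉ vs₂ := t₂.not_mem (fun e he => hv e (by simp [he])) (Ne.symm hve.2)
    have hz := key le_rfl (fun E => hy₁ (E ▸ t₁.right_mem)) (hh₁ z t₁.right_mem)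
    refine ⟨[[p], A, [p'], q' :: B, [q]], A ++ B, by simp, ?_, ?_, ?_, ?_, ?_, ?_, trivial⟩
    · classical
      have i₂ := hpq'.count_eq
      simp only [List.perm_iff_count, List.count_append, List.count_cons, List.flatten_cons,
        List.flatten_nil, List.count_nil] at i₁ i₂ ⊢
      intro a
      have := i₁ a
      have := i₂ a
      omega
    · refine chainList_oneWay' hp ?_ hx
      simp [dp', dq', dq]; omega
    · refine t₁.chainList_down n₁ ?_ ?_ fun u hu => ?_
      · simp; omega
      · simp [dp']; omega
      · have := key le_rfl (fun E => hy₁ (E ▸ hu)) (hh₁ u hu)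
        simp; omega
    · refine chainList_oneWay' hp' ?_ ?_
      · simp [dq', dq]; omega
      · simp; omega
    · refine (Trail.cons hq' t₂).chainList_down (List.nodup_cons.2 ⟨hv₂, n₂⟩) ?_ ?_
        fun u hu => ?_
      · simp [dq]; omega
      · simp; omega
      · rcases List.mem_cons.1 hu with rfl | hu
        · simp [dp, dp']; omega
        · have := key le_rfl (fun E => hy₂ (E ▸ hu)) (hh₂ u hu)
          simp; omega
    · refine chainList_oneWay hq ?_ ?_
      · simp [dp, dp', dq']; omega
      · have hzy : y ≠ z := fun E => hy₁ (E ▸ t₁.right_mem)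
        have hwy : y ≠ w := fun E => hy₂ (E ▸ t₂.left_mem)
        simpa [t₁.listDeg_eq_zero hy₁, t₂.listDeg_eq_zero hy₂,
          edgeDeg_eq hzw, hzy, hwy] using hby
  · obtain rfl : e₂ = e' := by simpa using hC
    obtain ⟨p', q', hp', hq', hpq'⟩ := s₂.orient hzw
    have dp' := edgeDeg_eq hp'
    have dq' := edgeDeg_eq hq'
    have hzy : z ≠ y := by rintro rfl; omega
    refine ⟨[[p], [p'], [q], [q']], [], by simp, ?_, ?_, ?_, ?_, ?_, trivial⟩
    · exact .trans (.cons _ (.swap _ _ _)) (by simpa using hpq.append hpq')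
    · refine chainList_oneWay' hp ?_ hx
      simp [dp', dq', dq]; omega
    · refine chainList_oneWay' hp' ?_ ?_
      · simp [dq', dq]; omega
      · have := key le_rfl hzy hz
        simp; omega
    · refine chainList_oneWay hq ?_ ?_
      · simp [dp, dp']; omega
      · simp [edgeDeg_eq hzw, hzy.symm] at hby
        simp [dq']; omega
    · refine chainList_oneWay hq' ?_ ?_
      · simp [dp, dp']; omega
      · simp; omega
/-! ### Pinching two edges of a sequence of chains -/

lemma Subdivides.listDeg_flatten {v : W} {e f g : E} (s : Subdivides ends v e f g)
    {P B : List (List E)} {R : List E} (hP : P.flatten.Perm (e :: R))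
    (hB : B.flatten.Perm (f :: g :: R)) (u : W) :
    listDeg ends B.flatten u = listDeg ends P.flatten u + bump v u := by
  rw [listDeg_perm hP, listDeg_perm hB, s.listDeg_eq]

/-- Either the first chain `C` of a sequence, containing the edge `e`, can be replaced by chains
in which `e` is subdivided at `v`, or the same can be done for the first two chains of the
sequence, or these two chains can be exchanged, or `C` is a single one-way chain. -/
lemma ChainSeq.step {h b : W → ℕ} {C : List E} {M : List (List E)} {v : W} {e f g : E}
    (H : ChainSeq ends h b (C :: M)) (he : e ∈ C) (s : Subdivides ends v e f g)
    (hv : ∀ e ∈ (C :: M).flatten, v ∉ ends e) :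
    Replaceable ends e f g h (b + bump v + listDeg ends M.flatten) [C] ∨
    (M = [] ∧ ∃ x y, C = [e] ∧ ends e = s(x, y) ∧ 2 ≤ h x ∧ 2 ≤ b y ∧ h y = 0) ∨
    (∃ D M', M = D :: M' ∧ ChainSeq ends h b (D :: C :: M')) ∨
    (∃ D M', M = D :: M' ∧
      Replaceable ends e f g h (b + bump v + listDeg ends M'.flatten) [C, D] ∧
      (∃ y, (∃ e ∈ D, y ∈ ends e) ∧ (h + listDeg ends C) y ≤ 1) ∧
      ∀ e ∈ D, ∀ u ∈ ends e, 2 ≤ (b + listDeg ends M'.flatten) u) := by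
  rcases H.1.replaceable (b' := b + bump v + listDeg ends M.flatten) he s
    (fun e he => hv e (by simp [he])) (fun u => by simp [Nat.add_assoc])
    (by simp [bump]; omega) with R | ⟨x, y, rfl, hxy, hx, hy, h0⟩
  · exact .inl R
  rcases M with _ | ⟨D, M⟩
  · exact .inr (.inl ⟨rfl, x, y, rfl, hxy, hx, by simpa using hy, h0⟩)
  have hve := hv e (by simp)
  simp only [hxy, Sym2.mem_iff, not_or] at hve
  rcases H.2.1.exchange hxy hx h0 (by simp at hy ⊢; omega) with
    K | ⟨vs, c, es, hes, t, hvs, hcy, hc, hb⟩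
  · refine .inr (.inr (.inl ⟨D, M, rfl, ?_⟩))
    have : ChainSeq ends h b ([D, [e]] ++ M) := chainSeq_append.2 ⟨K, H.2.2.congr
      (fun u => by simp; omega) fun _ => rfl⟩
    simpa using this
  · have hne : es ≠ [] := by rintro rfl; cases t; exact hcy rfl
    refine .inr (.inr (.inr ⟨D, M, rfl, ?_, ⟨y, ?_, ?_⟩, ?_⟩))
    · obtain ⟨p, q, hp, hq, hpq⟩ := s.orient hxy
      have dp := edgeDeg_eq hp
      have dq := edgeDeg_eq hq
      have hvv : v ∉ vs := t.not_mem
        (fun e he => hv e (by simp [hes.mem_iff.1 he])) (Ne.symm hve.2)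
      refine ⟨[[p], q :: es], D, by simp, by simpa using hpq.append hes, ?_, ?_, trivial⟩
      · refine chainList_oneWay' hp ?_ hx
        simp [bump]; omega
      · refine (Trail.cons hq t).chainList (List.nodup_cons.2 ⟨hvv, hvs⟩) ?_ ?_ fun u hu => ?_
        · simp [dp]; omega
        · simp; omega
        · rcases List.mem_cons.1 hu with rfl | hu
          · simp [bump]; omega
          · have := hb u hu
            simp at this ⊢; omega
    · obtain ⟨e', he', hy'⟩ := t.exists_mem_ends hne t.left_mem
      exact ⟨e', hes.mem_iff.1 he', hy'⟩
    · have : y ≠ x := by rintro rfl; omega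
      simp [edgeDeg_eq hxy, h0, this]
    · exact fun e' he' u hu => hb u (t.mem_of_mem_ends (hes.mem_iff.2 he') hu)

/-- Two disjoint parts of a sequence of chains can be replaced independently. -/
lemma ChainSeq.replace {h b : W → ℕ} {L₁ P Q P' L₂ : List (List E)} {v : W}
    {e₁ f₁ g₁ e₂ f₂ g₂ : E} {R : List E}
    (H : ChainSeq ends h b (L₁ ++ (P ++ (Q ++ (P' ++ L₂)))))
    (s₁ : Subdivides ends v e₁ f₁ g₁) (s₂ : Subdivides ends v e₂ f₂ g₂)
    (hR : (L₁ ++ (P ++ (Q ++ (P' ++ L₂)))).flatten.Perm (e₁ :: e₂ :: R))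
    (H₁ : Replaceable ends e₁ f₁ g₁ (h + listDeg ends L₁.flatten)
      (b + listDeg ends (Q ++ (P' ++ L₂)).flatten + bump v) P)
    (H₂ : Replaceable ends e₂ f₂ g₂ (b + listDeg ends L₂.flatten)
      (h + listDeg ends (L₁ ++ (P ++ Q)).flatten + bump v) P'.reverse) :
    ∃ L, ChainSeq ends h b L ∧ L.flatten.Perm (f₁ :: g₁ :: f₂ :: g₂ :: R) := by
  obtain ⟨B, R₁, p₁, q₁, K₁⟩ := H₁
  obtain ⟨B', R₂, p₂, q₂, K₂⟩ := H₂
  replace p₂ := (flatten_reverse_perm P').symm.trans p₂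
  replace q₂ := (flatten_reverse_perm B').trans q₂
  replace K₂ := K₂.reverse
  generalize B'.reverse = B'' at q₂ K₂
  have d₁ := s₁.listDeg_flatten p₁ q₁
  have d₂ := s₂.listDeg_flatten p₂ q₂
  simp only [chainSeq_append] at H
  refine ⟨L₁ ++ (B ++ (Q ++ (B'' ++ L₂))), ?_, ?_⟩
  · simp only [chainSeq_append]
    obtain ⟨h₁, h₂, h₃, h₄, h₅⟩ := H
    refine ⟨h₁.mono (fun _ => le_rfl) ?_, K₁.mono (fun _ => le_rfl) ?_, h₃.mono ?_ ?_,
      K₂.mono ?_ (fun _ => le_rfl), h₅.mono ?_ (fun _ => le_rfl)⟩ <;> intro u <;>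
      have := d₁ u <;> have := d₂ u <;> simp at * <;> omega
  · classical
    simp only [List.perm_iff_count, List.flatten_append, List.count_append,
      List.count_cons] at hR p₁ p₂ q₁ q₂ ⊢
    intro a
    have := hR a
    have := p₁ a
    have := p₂ a
    have := q₁ a
    have := q₂ a
    omega

lemma ChainSeq.pinch_adjacent {h b : W → ℕ} {L₁ L₂ : List (List E)} {C : List E} {v x y : W}
    {e₁ f₁ g₁ e₂ f₂ g₂ : E} {R : List E}
    (H : ChainSeq ends h b (L₁ ++ [e₁] :: C :: L₂)) (hC : e₂ ∈ C)
    (he : ends e₁ = s(x, y)) (hx : 2 ≤ (h + listDeg ends L₁.flatten) x)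
    (hy : (h + listDeg ends L₁.flatten) y = 0)
    (hby : 2 ≤ (b + listDeg ends (C :: L₂).flatten) y)
    (s₁ : Subdivides ends v e₁ f₁ g₁) (s₂ : Subdivides ends v e₂ f₂ g₂)
    (hR : (L₁ ++ [e₁] :: C :: L₂).flatten.Perm (e₁ :: e₂ :: R))
    (hv : ∀ e ∈ C, v ∉ ends e) :
    ∃ L, ChainSeq ends h b L ∧ L.flatten.Perm (f₁ :: g₁ :: f₂ :: g₂ :: R) := by
  obtain ⟨h₁, h₂, h₃, h₄⟩ := chainSeq_append.1 H
  obtain ⟨B, R', p, q, K⟩ := h₃.pinch_adjacent hC he hx hy (by simp at hby ⊢; omega) s₁ s₂ hv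
  have d : ∀ u, listDeg ends B.flatten u
      = listDeg ends [e₁] u + listDeg ends C u + 2 * bump v u := by
    intro u
    have i := s₁.listDeg_eq [] u
    have j := s₂.listDeg_eq R' u
    rw [listDeg_perm q, listDeg_perm p]
    simp at i j ⊢
    omega
  refine ⟨L₁ ++ (B ++ L₂), ?_, ?_⟩
  · simp only [chainSeq_append]
    refine ⟨h₁.mono (fun _ => le_rfl) ?_, K, h₄.mono ?_ (fun _ => le_rfl)⟩ <;> intro u <;>
      have := d u <;> simp at * <;> omega
  · classical
    simp only [List.perm_iff_count, List.flatten_append, List.flatten_cons, List.count_append,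
      List.count_cons, List.count_nil] at hR p q ⊢
    intro a
    have := hR a
    have := p a
    have := q a
    omega

lemma ChainSeq.pinch_separate {v : W} {e₁ f₁ g₁ e₂ f₂ g₂ : E} {R : List E}
    (s₁ : Subdivides ends v e₁ f₁ g₁) (s₂ : Subdivides ends v e₂ f₂ g₂)
    (hv : ∀ e ∈ e₁ :: e₂ :: R, v ∉ ends e) (n : ℕ) :
    ∀ {h b : W → ℕ} {L₁ M L₂ : List (List E)} {C₁ C₂ : List E}, M.length = n →
    ChainSeq ends h b (L₁ ++ C₁ :: (M ++ C₂ :: L₂)) → e₁ ∈ C₁ → e₂ ∈ C₂ →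
    (L₁ ++ C₁ :: (M ++ C₂ :: L₂)).flatten.Perm (e₁ :: e₂ :: R) →
    ∃ L, ChainSeq ends h b L ∧ L.flatten.Perm (f₁ :: g₁ :: f₂ :: g₂ :: R) := by
  induction n using Nat.strong_induction_on with
  | _ n ih =>
  intro h b L₁ M L₂ C₁ C₂ hn H hC₁ hC₂ hR
  subst hn
  have hvL : ∀ e ∈ (L₁ ++ C₁ :: (M ++ C₂ :: L₂)).flatten, v ∉ ends e :=
    fun e he => hv e (hR.mem_iff.1 he)
  obtain ⟨K₁, K⟩ := chainSeq_append.1 H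
  obtain ⟨A, K₂⟩ := (chainSeq_append (L₁ := C₁ :: M)).1 K
  obtain ⟨K₁', K'⟩ := (chainSeq_append (L₁ := L₁ ++ [C₁]) (L₂ := (M ++ [C₂]) ++ L₂)).1
    (by simpa using H)
  obtain ⟨A', K₂'⟩ := chainSeq_append.1 K'
  replace A' := A'.reverse
  rw [List.reverse_concat] at A'
  have hvA : ∀ e ∈ (C₁ :: M).flatten, v ∉ ends e :=
    fun e he => hvL e (by simp at he ⊢; grind)
  have hvA' : ∀ e ∈ (C₂ :: M.reverse).flatten, v ∉ ends e :=
    fun e he => hvL e (by simp at he ⊢; grind)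
  by_contra hcon
  obtain hE | hE := (A.step hC₁ s₁ hvA).imp_right fun hE => (hE.resolve_left (by
    rintro ⟨rfl, x, y, rfl, hxy, hx, hby, hy⟩
    exact hcon <| H.pinch_adjacent hC₂ hxy hx hy hby s₁ s₂ hR
      (fun e he => hvL e (by simp [he])))).resolve_left (by
    rintro ⟨D, M', rfl, X⟩
    refine hcon <| ih M'.length (by simp) (L₁ := L₁ ++ [D]) (M := M') (C₁ := C₁) (C₂ := C₂)
      (L₂ := L₂) rfl ?_ hC₁ hC₂ (.trans ?_ hR)
    · have : ChainSeq ends h b (L₁ ++ ((D :: C₁ :: M') ++ C₂ :: L₂)) :=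
        chainSeq_append.2 ⟨K₁.congr (fun _ => rfl) fun u => by simp; omega,
          chainSeq_append.2 ⟨X, K₂.congr (fun u => by simp; omega) fun _ => rfl⟩⟩
      simpa using this
    · classical
      simp only [List.perm_iff_count, List.flatten_append, List.flatten_cons, List.count_append]
      intro a
      simp
      omega)
  all_goals obtain hF | hF := (A'.step hC₂ s₂ hvA').imp_right fun hF => (hF.resolve_left (by
    rintro ⟨hM, x, y, rfl, hxy, hx, hby, hy⟩
    obtain rfl := List.reverse_eq_nil_iff.1 hM
    have hrev : (L₂.reverse ++ [e₂] :: C₁ :: L₁.reverse)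
      = (L₁ ++ C₁ :: ([] ++ [e₂] :: L₂)).reverse := by simp
    obtain ⟨L, hL, p⟩ := ChainSeq.pinch_adjacent (h := b) (b := h) (L₁ := L₂.reverse)
      (L₂ := L₁.reverse) (C := C₁) (R := R) (by rw [hrev]; exact H.reverse) hC₁ hxy
      (by simpa [listDeg_perm (flatten_reverse_perm L₂)] using hx)
      (by simpa [listDeg_perm (flatten_reverse_perm L₂)] using hy)
      (by simpa [listDeg_perm (flatten_reverse_perm L₁), Nat.add_comm, Nat.add_left_comm]
        using hby) s₂ s₁
      (by rw [hrev]
          exact ((flatten_reverse_perm _).trans hR).trans (.swap _ _ _))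
      (fun e he => hvL e (by simp [he]))
    refine hcon ⟨L.reverse, hL.reverse, ((flatten_reverse_perm L).trans p).trans ?_⟩
    exact List.perm_append_comm_assoc [f₂, g₂] [f₁, g₁] R)).resolve_left (by
    rintro ⟨D', M'', hM, X⟩
    obtain rfl : M = M''.reverse ++ [D'] := by simpa using congrArg List.reverse hM
    refine hcon <| ih M''.length (by simp) (L₁ := L₁) (M := M''.reverse) (C₁ := C₁) (C₂ := C₂)
      (L₂ := D' :: L₂) (by simp) ?_ hC₁ hC₂ (.trans ?_ hR)
    · have : ChainSeq ends h b ((L₁ ++ [C₁]) ++ ((D' :: C₂ :: M'').reverse ++ L₂)) :=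
        chainSeq_append.2 ⟨K₁'.congr (fun _ => rfl) fun u => by
            simp [listDeg_perm (flatten_reverse_perm M'')]; omega,
          chainSeq_append.2 ⟨X.reverse, K₂'.congr (fun u => by
            simp [listDeg_perm (flatten_reverse_perm M'')]; omega) fun _ => rfl⟩⟩
      simpa using this
    · classical
      simp only [List.perm_iff_count, List.flatten_append, List.flatten_cons, List.count_append]
      intro a
      simp
      omega)
  · refine hcon <| ChainSeq.replace (P := [C₁]) (Q := M) (P' := [C₂]) H s₁ s₂ hR
      (hE.mono (fun _ => le_rfl) fun u => ?_) (hF.mono (fun _ => le_rfl) fun u => ?_)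
    · simp; omega
    · simp [listDeg_perm (flatten_reverse_perm M)]; omega
  · obtain ⟨D', M'', hM, hF, -⟩ := hF
    obtain rfl : M = M''.reverse ++ [D'] := by simpa using congrArg List.reverse hM
    refine hcon <| ChainSeq.replace (P := [C₁]) (Q := M''.reverse) (P' := [D', C₂])
      (L₁ := L₁) (L₂ := L₂) (R := R) (by simpa using H) s₁ s₂ (by simpa using hR)
      (hE.mono (fun _ => le_rfl) fun u => ?_) (hF.mono (fun _ => le_rfl) fun u => ?_)
    · simp; omega
    · simp [listDeg_perm (flatten_reverse_perm M'')]; omega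
  · obtain ⟨D, M', rfl, hE, -⟩ := hE
    refine hcon <| ChainSeq.replace (P := [C₁, D]) (Q := M') (P' := [C₂])
      (L₁ := L₁) (L₂ := L₂) (R := R) (by simpa using H) s₁ s₂ (by simpa using hR)
      (hE.mono (fun _ => le_rfl) fun u => ?_) (hF.mono (fun _ => le_rfl) fun u => ?_)
    · simp; omega
    · simp [listDeg_perm (flatten_reverse_perm M')]; omega
  · obtain ⟨D, M', rfl, hE, ⟨y, ⟨e, he, hye⟩, hy⟩, -⟩ := hE
    obtain ⟨D', M'', hM, hF, -, hF'⟩ := hF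
    rcases M'.eq_nil_or_concat with rfl | ⟨Q, T, rfl⟩
    · obtain ⟨rfl, rfl⟩ : D = D' ∧ [] = M'' := by simpa using hM
      have := hF' e he y hye
      simp at this hy
      omega
    · obtain ⟨rfl, rfl⟩ : T = D' ∧ Q.reverse ++ [D] = M'' := by simpa using hM
      refine hcon <| ChainSeq.replace (P := [C₁, D]) (Q := Q) (P' := [T, C₂])
        (L₁ := L₁) (L₂ := L₂) (R := R) (by simpa using H) s₁ s₂ (by simpa using hR)
        (hE.mono (fun _ => le_rfl) fun u => ?_) (hF.mono (fun _ => le_rfl) fun u => ?_)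
      · simp; omega
      · simp [listDeg_perm (flatten_reverse_perm Q)]; omega

lemma ChainList.pinch_ordered {h b : W → ℕ} {es₁ es₂ es₃ : List E} {v : W}
    {e₁ f₁ g₁ e₂ f₂ g₂ : E}
    (H : ChainList ends h b (es₁ ++ e₁ :: (es₂ ++ e₂ :: es₃)))
    (s₁ : Subdivides ends v e₁ f₁ g₁) (s₂ : Subdivides ends v e₂ f₂ g₂)
    (hv : ∀ e ∈ es₁ ++ e₁ :: (es₂ ++ e₂ :: es₃), v ∉ ends e) :
    ∃ B, B.flatten.Perm (f₁ :: g₁ :: f₂ :: g₂ :: (es₁ ++ (es₂ ++ es₃))) ∧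
      ChainSeq ends h b B := by
  rcases H with H | H | H | ⟨e, x, y, H, -⟩
  · simp at H
  · exact H.pinch_ordered s₁ s₂ hv
  · obtain ⟨B, p, K⟩ := H.pinch_ordered s₁ s₂ hv
    exact ⟨B.reverse, (flatten_reverse_perm B).trans p, K.reverse⟩
  · have := congrArg List.length H
    simp at this
    omega

lemma ChainSeq.pinch_ordered {h b : W → ℕ} {L₁ L₂ : List (List E)} {es₁ es₂ es₃ : List E}
    {v : W} {e₁ f₁ g₁ e₂ f₂ g₂ : E} {R : List E}
    (H : ChainSeq ends h b (L₁ ++ (es₁ ++ e₁ :: (es₂ ++ e₂ :: es₃)) :: L₂))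
    (s₁ : Subdivides ends v e₁ f₁ g₁) (s₂ : Subdivides ends v e₂ f₂ g₂)
    (hR : (L₁ ++ (es₁ ++ e₁ :: (es₂ ++ e₂ :: es₃)) :: L₂).flatten.Perm (e₁ :: e₂ :: R))
    (hv : ∀ e ∈ es₁ ++ e₁ :: (es₂ ++ e₂ :: es₃), v ∉ ends e) :
    ∃ L, ChainSeq ends h b L ∧ L.flatten.Perm (f₁ :: g₁ :: f₂ :: g₂ :: R) := by
  obtain ⟨h₁, h₂, h₃⟩ := chainSeq_append.1 H
  obtain ⟨B, q, K⟩ := h₂.pinch_ordered s₁ s₂ hv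
  have d : ∀ u, listDeg ends B.flatten u
      = listDeg ends (es₁ ++ e₁ :: (es₂ ++ e₂ :: es₃)) u + 2 * bump v u := by
    intro u
    have i := s₁.listDeg_eq [] u
    have j := s₂.listDeg_eq [] u
    rw [listDeg_perm q]
    simp at i j ⊢
    omega
  refine ⟨L₁ ++ (B ++ L₂), ?_, ?_⟩
  · simp only [chainSeq_append]
    refine ⟨h₁.mono (fun _ => le_rfl) ?_, K, h₃.mono ?_ (fun _ => le_rfl)⟩ <;> intro u <;>
      have := d u <;> simp at * <;> omega
  · classical
    simp only [List.perm_iff_count, List.flatten_append, List.flatten_cons, List.count_append,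
      List.count_cons] at hR q ⊢
    intro a
    have := hR a
    have := q a
    omega

/-- Two edges of a sequence of chains can be pinched together. -/
theorem ChainSeq.pinch {h b : W → ℕ} {L : List (List E)} {v : W} {e₁ f₁ g₁ e₂ f₂ g₂ : E}
    {R : List E} (H : ChainSeq ends h b L)
    (s₁ : Subdivides ends v e₁ f₁ g₁) (s₂ : Subdivides ends v e₂ f₂ g₂)
    (hR : L.flatten.Perm (e₁ :: e₂ :: R)) (hv : ∀ e ∈ L.flatten, v ∉ ends e) :
    ∃ L', ChainSeq ends h b L' ∧ L'.flatten.Perm (f₁ :: g₁ :: f₂ :: g₂ :: R) := by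
  have hR' := hR.trans (.swap e₂ e₁ R)
  have swap {L' : List (List E)} (p : L'.flatten.Perm (f₂ :: g₂ :: f₁ :: g₁ :: R)) :
      L'.flatten.Perm (f₁ :: g₁ :: f₂ :: g₂ :: R) :=
    p.trans (List.perm_append_comm_assoc [f₂, g₂] [f₁, g₁] R)
  obtain ⟨C, hC, he₁⟩ := List.mem_flatten.1 (hR.symm.subset (List.mem_cons_self ..))
  obtain ⟨L₁, L₂, rfl⟩ := List.append_of_mem hC
  obtain ⟨A, B, rfl⟩ := List.append_of_mem he₁
  have hp : (L₁.flatten ++ (L₂.flatten ++ (A ++ B))).Perm (e₂ :: R) := by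
    classical
    simp only [List.perm_iff_count, List.flatten_append, List.flatten_cons, List.count_append,
      List.count_cons] at hR ⊢
    intro a
    have := hR a
    omega
  have he₂ := hp.symm.subset (List.mem_cons_self ..)
  simp only [List.mem_append] at he₂
  rcases he₂ with he₂ | he₂ | he₂ | he₂
  · obtain ⟨D, hD, he₂'⟩ := List.mem_flatten.1 he₂
    obtain ⟨L₁, M, rfl⟩ := List.append_of_mem hD
    obtain ⟨L, hL, p⟩ := ChainSeq.pinch_separate s₂ s₁ (fun e he => hv e (hR'.mem_iff.2 he)) _
      (M := M) (L₁ := L₁) (L₂ := L₂) rfl (by simpa using H) he₂' he₁ (by simpa using hR')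
    exact ⟨L, hL, swap p⟩
  · obtain ⟨D, hD, he₂'⟩ := List.mem_flatten.1 he₂
    obtain ⟨M, L₂, rfl⟩ := List.append_of_mem hD
    exact ChainSeq.pinch_separate s₁ s₂ (fun e he => hv e (hR.mem_iff.2 he)) _ rfl H he₁ he₂' hR
  · obtain ⟨A₁, A₂, rfl⟩ := List.append_of_mem he₂
    rw [List.append_assoc, List.cons_append] at H hR' hv
    obtain ⟨L, hL, p⟩ := ChainSeq.pinch_ordered H s₂ s₁ hR'
      (fun e he => hv e (by simp at he ⊢; grind))
    exact ⟨L, hL, swap p⟩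
  · obtain ⟨B₁, B₂, rfl⟩ := List.append_of_mem he₂
    exact ChainSeq.pinch_ordered H s₁ s₂ hR (fun e he => hv e (by simp at he ⊢; grind))

/-! ### Sequences of chains under maps of edges and vertices -/

section Map

variable {F W' : Type} {φ : F → E}

lemma listDeg_map (es : List F) (u : W) :
    listDeg ends (es.map φ) u = listDeg (fun e => ends (φ e)) es u := by
  simp [listDeg, edgeDeg, Function.comp_def]

lemma trail_map {es : List F} {vs : List W} {a c : W} :
    Trail ends a vs (es.map φ) c ↔ Trail (fun e => ends (φ e)) a vs es c := by
  induction es generalizing a vs with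
  | nil => constructor <;> intro t <;> cases t <;> exact .nil _
  | cons e es ih =>
    constructor
    · intro t
      cases t with
      | cons h t => exact .cons h (ih.1 t)
    · intro t
      cases t with
      | cons h t => exact .cons h (ih.2 t)

lemma upList_map {h b : W → ℕ} {es : List F} :
    UpList ends h b (es.map φ) ↔ UpList (fun e => ends (φ e)) h b es := by
  simp only [UpList, trail_map]

lemma oneWayList_map {h b : W → ℕ} {es : List F} :
    OneWayList ends h b (es.map φ) ↔ OneWayList (fun e => ends (φ e)) h b es := by
  constructor
  · rintro ⟨e, u, w, he, h⟩
    obtain ⟨e, rfl, rfl⟩ := List.map_eq_singleton_iff.1 he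
    exact ⟨e, u, w, rfl, h⟩
  · rintro ⟨e, u, w, rfl, h⟩
    exact ⟨φ e, u, w, rfl, h⟩

lemma chainSeq_map {h b : W → ℕ} {L : List (List F)} :
    ChainSeq ends h b (L.map (List.map φ)) ↔ ChainSeq (fun e => ends (φ e)) h b L := by
  induction L generalizing h with
  | nil => exact .rfl
  | cons C L ih =>
    have d (es : List F) : listDeg ends (es.map φ) = listDeg (fun e => ends (φ e)) es :=
      funext (listDeg_map es)
    simp only [List.map_cons, ChainSeq, ih, ChainList, upList_map, oneWayList_map,
      List.map_eq_nil_iff, ← List.map_flatten, d]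

variable {ψ : W → W'}

lemma listDeg_map_verts (hψ : ψ.Injective) (es : List E) (u : W) :
    listDeg (fun e => (ends e).map ψ) es (ψ u) = listDeg ends es u := by
  have : ∀ e, edgeDeg (fun e => (ends e).map ψ) e (ψ u) = edgeDeg ends e u := by
    intro e
    have h₁ : ψ u ∈ (ends e).map ψ ↔ u ∈ ends e := by simp [Sym2.mem_map, hψ.eq_iff]
    have h₂ : (ends e).map ψ = s(ψ u, ψ u) ↔ ends e = s(u, u) := by
      rw [← Sym2.map_mk, (Sym2.map.injective hψ).eq_iff]
    classical
    unfold edgeDeg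
    congr 1
    · exact if_congr h₁ rfl rfl
    · exact if_congr h₂ rfl rfl
  simp only [listDeg, this]

lemma Trail.map_verts {a c : W} {vs : List W} {es : List E} (t : Trail ends a vs es c) :
    Trail (fun e => (ends e).map ψ) (ψ a) (vs.map ψ) es (ψ c) := by
  induction t with
  | nil => exact .nil _
  | cons h _ ih => exact .cons (by simp [h]) ih

lemma UpList.map_verts (hψ : ψ.Injective) {h b : W → ℕ} {h' b' : W' → ℕ} {es : List E}
    (hh : ∀ u, h u = h' (ψ u)) (hb : ∀ u, b u = b' (ψ u)) (H : UpList ends h b es) :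
    UpList (fun e => (ends e).map ψ) h' b' es := by
  obtain ⟨a, vs, c, t, h₁, h₂, ha, hc, hac, hbb⟩ := H
  refine ⟨ψ a, vs.map ψ, ψ c, t.map_verts, ?_, ?_, hh a ▸ ha, hh c ▸ hc,
    fun e => hh a ▸ hac (hψ e), ?_⟩
  · rw [← List.map_tail]
    exact h₁.map hψ
  · rw [← List.map_dropLast]
    exact h₂.map hψ
  · simpa [← hb] using hbb

lemma ChainSeq.map_verts (hψ : ψ.Injective) {h b : W → ℕ} {h' b' : W' → ℕ} {L : List (List E)}
    (hh : ∀ u, h u = h' (ψ u)) (hb : ∀ u, b u = b' (ψ u)) (H : ChainSeq ends h b L) :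
    ChainSeq (fun e => (ends e).map ψ) h' b' L := by
  induction L generalizing h h' with
  | nil => trivial
  | cons C L ih =>
    have hb' : ∀ u, (b + listDeg ends L.flatten) u
        = (b' + listDeg (fun e => (ends e).map ψ) L.flatten) (ψ u) := by
      simp [listDeg_map_verts hψ, hb]
    refine ⟨?_, ih (by simp [listDeg_map_verts hψ, hh]) H.2⟩
    rcases H.1 with H | H | H | ⟨e, u, w, rfl, he, hu, hw⟩
    · exact .inl H
    · exact .inr (.inl (H.map_verts hψ hh hb'))
    · exact .inr (.inr (.inl (H.map_verts hψ hb' hh)))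
    · exact .inr (.inr (.inr ⟨e, ψ u, ψ w, rfl, by simp [he], hh u ▸ hu, hb' w ▸ hw⟩))

end Map

lemma ChainSeq.filter_not_isEmpty {h b : W → ℕ} {L : List (List E)} (H : ChainSeq ends h b L) :
    ChainSeq ends h b (L.filter fun C => !C.isEmpty) := by
  induction L generalizing h with
  | nil => trivial
  | cons C L ih =>
    rcases eq_or_ne C [] with rfl | hC
    · simpa using ih (H.2.congr (by simp) fun _ => rfl)
    · rw [List.filter_cons_of_pos (by simpa using hC)]
      refine ⟨?_, ih H.2⟩
      rw [List.flatten_filter_not_isEmpty]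
      exact H.1

end ChainLists

/-! ### Chain decompositions as sequences of chains -/

section Decomp

variable {G : MG} {r : G.V}

lemma deg_setOf_mem {es : List G.E} (hes : es.Nodup) :
    G.deg {e | e ∈ es} = listDeg G.ends es := by
  classical
  ext u
  have key (p : G.E → Prop) : {e ∈ {e | e ∈ es} | p e}.ncard = es.countP (fun e => p e) := by
    have : {e ∈ {e | e ∈ es} | p e} = ((es.filter (fun e => p e)).toFinset : Set G.E) := by
      ext e; simp
    rw [this, Set.ncard_coe_finset, List.toFinset_card_of_nodup (hes.filter _),
      List.countP_eq_length_filter]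
  rw [deg, key, key]
  clear key hes
  induction es with
  | nil => simp
  | cons e es ih =>
    simp only [listDeg_cons, ← ih, edgeDeg, List.countP_cons, decide_eq_true_eq]
    split_ifs <;> omega

lemma one_le_deg_iff [Finite G.E] {F : Set G.E} {u : G.V} : 1 ≤ G.deg F u ↔ u ∈ G.vertsOf F := by
  constructor
  · intro h
    by_contra hu
    have h₁ : {e ∈ F | u ∈ G.ends e} = ∅ :=
      Set.eq_empty_of_forall_notMem fun e he => hu ⟨e, he⟩
    have h₂ : {e ∈ F | G.ends e = s(u, u)} = ∅ :=
      Set.eq_empty_of_forall_notMem fun e he => hu ⟨e, he.1, by simp [he.2]⟩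
    simp [deg, h₁, h₂] at h
  · rintro ⟨e, he⟩
    have : 0 < {e ∈ F | u ∈ G.ends e}.ncard := (Set.ncard_pos (Set.toFinite _)).2 ⟨e, he⟩
    rw [deg]
    omega

lemma isLink_iff {vs : List G.V} {es : List G.E} :
    G.IsLink vs es ↔ ∃ a c, Trail G.ends a vs es c := by
  induction es generalizing vs with
  | nil =>
    constructor
    · intro h
      match vs, h with
      | [a], _ => exact ⟨a, a, .nil a⟩
    · rintro ⟨a, c, t⟩
      cases t
      trivial
  | cons e es ih =>
    constructor
    · intro h
      match vs, h with
      | a :: b :: vs, ⟨he, h⟩ =>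
        obtain ⟨a', c, t⟩ := ih.1 h
        obtain rfl : b = a' := by simpa using t.head?
        exact ⟨a, c, .cons he t⟩
    · rintro ⟨a, c, t⟩
      cases t with
      | @cons _ u _ _ vs _ he t =>
        have := ih.2 ⟨u, c, t⟩
        cases t <;> exact ⟨he, this⟩

lemma two_le_iff {d : G.V → ℕ} {u : G.V} : 2 ≤ (bump r + d) u ↔ u = r ∨ 2 ≤ d u := by
  simp only [bump, Pi.add_apply]
  split_ifs with h <;> simp [h]

lemma one_le_iff [Finite G.E] {F : Set G.E} {u : G.V} :
    1 ≤ (bump r + G.deg F) u ↔ u = r ∨ u ∈ G.vertsOf F := by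
  rw [← one_le_deg_iff]
  simp only [bump, Pi.add_apply]
  split_ifs with h
  · simp [h]; omega
  · simp [h]

lemma IsUpChain.exists_upList [Finite G.E] {H Hb C : Set G.E} (h : G.IsUpChain r H Hb C) :
    ∃ es, es.Nodup ∧ C = {e | e ∈ es} ∧
      UpList G.ends (bump r + G.deg H) (bump r + G.deg Hb) es := by
  rcases h with ⟨-, -, vs, es, ⟨hvs, hes, hl⟩, hne, hC, hb, h₁, h₂⟩ |
    ⟨v, -, -, vs, es, ⟨hvs, hes, hne, hl⟩, hC, hb, hv⟩
  · obtain ⟨a, c, t⟩ := isLink_iff.1 hl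
    exact ⟨es, hes, hC, a, vs, c, t, hvs.sublist (List.tail_sublist _),
      hvs.sublist (List.dropLast_sublist _), one_le_iff.2 (h₁ a t.head?),
      one_le_iff.2 (h₂ c t.getLast?), fun e => absurd e (t.left_ne_right hvs hne),
      fun u hu => two_le_iff.2 (hb u hu)⟩
  · obtain ⟨a, c, t⟩ := isLink_iff.1 hl
    obtain rfl : v = a := by simpa using t.head?
    obtain rfl : v = c := by simpa [List.getLast?_cons] using t.getLast?
    have hv' := two_le_iff.2 hv
    refine ⟨es, hes, hC, v, _, v, t, ?_, ?_, le_trans (by simp) hv', le_trans (by simp) hv',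
      fun _ => hv', fun u hu => two_le_iff.2 (hb u ?_)⟩
    · exact List.nodup_append_comm.1 (by simpa using hvs)
    · rw [← List.cons_append, List.dropLast_concat]
      exact hvs
    · simp at hu ⊢; tauto

lemma UpList.isUpChain [Finite G.E] {H Hb : Set G.E} {es : List G.E}
    (h : UpList G.ends (bump r + G.deg H) (bump r + G.deg Hb) es) (hne : es ≠ []) (hes : es.Nodup)
    (hH : Disjoint {e | e ∈ es} H) (hHb : Disjoint {e | e ∈ es} Hb) :
    G.IsUpChain r H Hb {e | e ∈ es} := by
  obtain ⟨a, vs, c, t, h₁, h₂, ha, hc, hac, hb⟩ := h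
  have hl := isLink_iff.2 ⟨a, c, t⟩
  replace hb := fun u hu => two_le_iff.1 (hb u hu)
  rcases eq_or_ne a c with rfl | h
  · refine .inr ⟨a, hH, hHb, ?_⟩
    obtain ⟨vs', rfl⟩ : ∃ vs', vs = a :: (vs' ++ [a]) := by
      cases t with
      | nil => exact absurd rfl hne
      | @cons _ _ _ _ vs _ _ t =>
        exact ⟨vs.dropLast, by rw [List.dropLast_append_getLast? a t.getLast?]⟩
    rw [← List.cons_append, List.dropLast_concat] at h₂
    exact ⟨vs', es, ⟨h₂, hes, hne, hl⟩, rfl, fun u hu => hb u (by simp at hu ⊢; tauto),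
      two_le_iff.1 (hac rfl)⟩
  · refine .inl ⟨hH, hHb, vs, es, ⟨t.nodup h₁ h₂ h, hes, hl⟩, hne, rfl, hb, ?_, ?_⟩
    · intro v hv
      obtain rfl : a = v := by simpa [t.head?] using hv
      exact one_le_iff.1 ha
    · intro v hv
      obtain rfl : c = v := by simpa [t.getLast?] using hv
      exact one_le_iff.1 hc

lemma IsChain.exists_chainList [Finite G.E] {H Hb C : Set G.E} (h : G.IsChain r H Hb C) :
    ∃ es, es.Nodup ∧ C = {e | e ∈ es} ∧
      ChainList G.ends (bump r + G.deg H) (bump r + G.deg Hb) es := by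
  rcases h with h | h | ⟨u, w, e, -, -, hC, he, hu, hw⟩
  · obtain ⟨es, hes, hC, h⟩ := h.exists_upList
    exact ⟨es, hes, hC, .inr (.inl h)⟩
  · obtain ⟨es, hes, hC, h⟩ := IsUpChain.exists_upList h
    exact ⟨es, hes, hC, .inr (.inr (.inl h))⟩
  · exact ⟨[e], by simp, by simpa [Set.ext_iff] using hC,
      chainList_oneWay he (two_le_iff.2 hu) (two_le_iff.2 hw)⟩

lemma ChainList.isChain [Finite G.E] {H Hb : Set G.E} {es : List G.E}
    (h : ChainList G.ends (bump r + G.deg H) (bump r + G.deg Hb) es) (hne : es ≠ [])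
    (hes : es.Nodup) (hH : Disjoint {e | e ∈ es} H) (hHb : Disjoint {e | e ∈ es} Hb) :
    G.IsChain r H Hb {e | e ∈ es} := by
  rcases h with h | h | h | ⟨e, u, w, rfl, he, hu, hw⟩
  · exact absurd h hne
  · exact .inl (h.isUpChain hne hes hH hHb)
  · exact .inr (.inl (h.isUpChain hne hes hHb hH))
  · exact .inr (.inr ⟨u, w, e, fun h => Set.disjoint_left.1 hH (by simp) h,
      fun h => Set.disjoint_left.1 hHb (by simp) h, by simp, he, two_le_iff.1 hu,
      two_le_iff.1 hw⟩)

lemma before_get (L : List (List G.E)) (i : Fin L.length) :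
    G.before (fun i => {e | e ∈ L.get i}) i = {e | e ∈ (L.take i).flatten} := by
  ext e
  simp only [before, Set.mem_ofPred_eq, List.mem_flatten, List.mem_take_iff_getElem]
  constructor
  · rintro ⟨j, hj, he⟩
    exact ⟨_, ⟨j, by have := j.2; have : (j : ℕ) < i := hj; omega, rfl⟩, he⟩
  · rintro ⟨C, ⟨j, hj, rfl⟩, he⟩
    exact ⟨⟨j, by omega⟩, show j < (i : ℕ) by omega, he⟩

lemma after_get (L : List (List G.E)) (i : Fin L.length) :
    G.after (fun i => {e | e ∈ L.get i}) i = {e | e ∈ (L.drop (i + 1)).flatten} := by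
  ext e
  simp only [after, Set.mem_ofPred_eq, List.mem_flatten, List.mem_drop_iff_getElem]
  constructor
  · rintro ⟨j, hj, he⟩
    have : (i : ℕ) < j := hj
    exact ⟨_, ⟨j - (i + 1), by omega, rfl⟩,
      by simpa [show (i : ℕ) + 1 + (j - (i + 1)) = j by omega] using he⟩
  · rintro ⟨C, ⟨j, hj, rfl⟩, he⟩
    exact ⟨⟨i + 1 + j, by omega⟩, show (i : ℕ) < i + 1 + j by omega, he⟩


lemma IsChainDecomp.exists_chainSeq [Finite G.E] {n : ℕ} {Gs : Fin n → Set G.E}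
    (h : G.IsChainDecomp r Gs) :
    ∃ L, ChainSeq G.ends (bump r) (bump r) L ∧ L.flatten.Nodup ∧ ∀ e, e ∈ L.flatten := by
  obtain ⟨hd, hu, hc⟩ := h
  choose es hes hG hC using fun i => (hc i).exists_chainList
  obtain ⟨L, rfl, hL⟩ : ∃ (L : List (List G.E)) (h : n = L.length), ∀ i, es i = L.get (i.cast h) :=
    ⟨List.ofFn es, by simp, by simp⟩
  obtain rfl : es = L.get := funext hL
  obtain rfl : Gs = fun i => {e | e ∈ L.get i} := funext hG
  have hn : L.flatten.Nodup := by
    refine List.nodup_flatten.2 ⟨fun C hC => ?_, List.pairwise_iff_get.2 fun i j hij => ?_⟩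
    · obtain ⟨i, rfl⟩ := List.get_of_mem hC
      exact hes i
    · exact fun e he he' => Set.disjoint_left.1 (hd i j hij.ne) he he'
  refine ⟨L, chainSeq_iff.2 fun A C B e => ?_, hn, fun e => ?_⟩
  · subst e
    have := hC ⟨A.length, by simp⟩
    simp only [List.flatten_append, List.flatten_cons, List.nodup_append] at hn
    rw [before_get, after_get, deg_setOf_mem (by simpa using hn.1),
      deg_setOf_mem (by simpa using hn.2.1.2.1)] at this
    simpa using this
  · obtain ⟨i, hi⟩ := Set.mem_iUnion.1 (hu ▸ Set.mem_univ e)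
    exact List.mem_flatten.2 ⟨_, List.get_mem L i, hi⟩

lemma isChainDecomp_get [Finite G.E] {L : List (List G.E)}
    (H : ChainSeq G.ends (bump r) (bump r) L) (hL : ∀ C ∈ L, C ≠ []) (hn : L.flatten.Nodup)
    (hu : ∀ e, e ∈ L.flatten) :
    G.IsChainDecomp r fun i : Fin L.length => {e | e ∈ L.get i} := by
  refine ⟨fun i j hij => ?_, ?_, fun i => ?_⟩
  · have hp := List.pairwise_iff_get.1 (List.nodup_flatten.1 hn).2
    rcases hij.lt_or_gt with h | h
    · exact Set.disjoint_left.2 fun e he he' => hp i j h he he'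
    · exact Set.disjoint_left.2 fun e he he' => hp j i h he' he
  · refine Set.eq_univ_of_forall fun e => ?_
    obtain ⟨C, hC, he⟩ := List.mem_flatten.1 (hu e)
    obtain ⟨i, rfl⟩ := List.get_of_mem hC
    exact Set.mem_iUnion.2 ⟨i, he⟩
  · have e : L = L.take i ++ L.get i :: L.drop (i + 1) := by simp
    have h := chainSeq_iff.1 H _ _ _ e
    rw [e] at hn
    simp only [List.flatten_append, List.flatten_cons, List.nodup_append] at hn
    rw [← deg_setOf_mem hn.1, ← deg_setOf_mem hn.2.1.2.1] at h
    rw [before_get, after_get]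
    refine h.isChain (hL _ (List.get_mem L i)) hn.2.1.1
      (Set.disjoint_left.2 fun a ha ha' => ?_) (Set.disjoint_left.2 fun a ha ha' => ?_)
    · exact hn.2.2 a ha' a (List.mem_append_left _ ha) rfl
    · exact hn.2.1.2.2 a ha a ha' rfl

lemma hasChainDecomp_of_chainSeq [Finite G.E] [Nonempty G.E] {L : List (List G.E)}
    (H : ChainSeq G.ends (bump r) (bump r) L) (hn : L.flatten.Nodup) (hu : ∀ e, e ∈ L.flatten) :
    G.HasChainDecomp r := by
  have h := List.flatten_filter_not_isEmpty (L := L)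
  obtain ⟨n, Gs, hG⟩ : ∃ n, ∃ Gs : Fin n → Set G.E, G.IsChainDecomp r Gs :=
    ⟨_, _, isChainDecomp_get H.filter_not_isEmpty (by simp) (h.symm ▸ hn) (h.symm ▸ hu)⟩
  cases n with
  | zero => simpa using (hG.2.1 ▸ Set.mem_univ (Classical.arbitrary G.E) : _ ∈ ⋃ i, Gs i)
  | succ m => exact ⟨m, Gs, hG⟩

end Decomp

end MG

theorem chain_decomp_pinch (G : MG) [Finite G.V] [Finite G.E]
    (r : G.V) (h : G.HasChainDecomp r) (e₁ e₂ : G.E) (hne : e₁ ≠ e₂)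
    (x y z w : G.V) (h₁ : G.ends e₁ = s(x, y)) (h₂ : G.ends e₂ = s(z, w)) :
    (G.pinch e₁ e₂ x y z w).HasChainDecomp (some r) := by
  obtain ⟨m, Gs, hG⟩ := h
  obtain ⟨L, hL, hn, hu⟩ := hG.exists_chainSeq
  obtain ⟨R, hR⟩ : ∃ R, L.flatten.Perm (e₁ :: e₂ :: R) := by
    classical
    exact ⟨(L.flatten.erase e₁).erase e₂, (List.perm_cons_erase (hu e₁)).trans <|
      .cons _ (List.perm_cons_erase ((List.mem_erase_of_ne hne.symm).2 (hu e₂)))⟩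
  have hnR := hR.nodup_iff.1 hn
  obtain ⟨R, rfl⟩ : R ∈ Set.range (List.map (Subtype.val : {e // e ≠ e₁ ∧ e ≠ e₂} → G.E)) := by
    rw [Set.range_list_map]
    simp at hnR ⊢
    grind
  -- The edges of the pinched graph, together with `e₁` and `e₂`.
  let ends : G.E ⊕ Fin 4 → Sym2 (Option G.V) := Sum.elim (fun e => (G.ends e).map some)
    (fun i =>
      if i = 0 then s(none, some x)
      else if i = 1 then s(none, some y)
      else if i = 2 then s(none, some z)
      else s(none, some w))
  let φ : {e : G.E // e ≠ e₁ ∧ e ≠ e₂} ⊕ Fin 4 → G.E ⊕ Fin 4 := Sum.map Subtype.val id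
  have hφ : φ.Injective := Subtype.val_injective.sumMap Function.injective_id
  have hends : (fun e => ends (φ e)) = (G.pinch e₁ e₂ x y z w).ends := by
    funext e; rcases e with e | i <;> rfl
  have s₁ : MG.Subdivides ends none (.inl e₁) (.inr 0) (.inr 1) :=
    ⟨some x, some y, by simp [ends, h₁], rfl, rfl⟩
  have s₂ : MG.Subdivides ends none (.inl e₂) (.inr 2) (.inr 3) :=
    ⟨some z, some w, by simp [ends, h₂], rfl, rfl⟩
  have hb (u : G.V) : MG.bump r u = MG.bump (some r) (some u) := by
    by_cases h : u = r <;> simp [MG.bump, h]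
  have K : MG.ChainSeq ends (MG.bump (some r)) (MG.bump (some r)) (L.map (List.map Sum.inl)) :=
    MG.chainSeq_map.2 (hL.map_verts (Option.some_injective _) hb hb)
  have hR' : (L.map (List.map (Sum.inl : G.E → G.E ⊕ Fin 4))).flatten.Perm
      (.inl e₁ :: .inl e₂ :: (R.map Subtype.val).map Sum.inl) := by
    rw [← List.map_flatten]
    exact hR.map Sum.inl
  obtain ⟨L', K', hL'⟩ := K.pinch s₁ s₂ hR' (by simp [← List.map_flatten, ends])
  have hR'' : (R.map Subtype.val).map (Sum.inl : G.E → G.E ⊕ Fin 4) = (R.map Sum.inl).map φ := by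
    rw [List.map_map, List.map_map]
    rfl
  rw [hR''] at hL'
  replace hL' : L'.flatten.Perm
    ((.inr 0 :: .inr 1 :: .inr 2 :: .inr 3 :: R.map Sum.inl).map φ) := hL'
  obtain ⟨L', rfl⟩ : L' ∈ Set.range (List.map (List.map φ)) := by
    rw [Set.range_list_map, Set.range_list_map]
    intro C hC e he
    obtain ⟨e', -, h⟩ := List.mem_map.1 (hL'.subset (List.mem_flatten_of_mem hC he))
    exact ⟨e', h⟩
  rw [← List.map_flatten, List.map_perm_map_iff hφ] at hL'
  rw [MG.chainSeq_map, hends] at K'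
  have : Finite (G.pinch e₁ e₂ x y z w).E :=
    inferInstanceAs (Finite ({e : G.E // e ≠ e₁ ∧ e ≠ e₂} ⊕ Fin 4))
  have : Nonempty (G.pinch e₁ e₂ x y z w).E := ⟨.inr 0⟩
  refine MG.hasChainDecomp_of_chainSeq K' (hL'.nodup_iff.2 ?_) fun e => hL'.mem_iff.2 ?_
  · have := hnR.of_cons.of_cons.of_map.map (Sum.inl_injective (β := Fin 4))
    simp [this]
  · rcases e with e | i
    · have := hR.subset (hu e.1)
      simp only [List.mem_cons, e.2.1, e.2.2, false_or,
        List.mem_map_of_injective Subtype.val_injective] at this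
      simpa using this
    · fin_cases i <;> simp
end
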